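/- arXiv:2111.03450 — 4 statements merged into one kernel-verified Lean document; each statement's English description precedes it below -/
import Mathlib

section
/- There exists a constant C > 0 such that the following holds. For every directed graph G on a finite vertex set V of cardinality n with arc set E ⊆ V × V, every pair of distinct vertices s, t ∈ V, and every natural number k, there exists a family 𝒜 of subsets of V × V with |𝒜| ≤ 2^(C·(k+2)^4·log(k+2)) · (2 + log n)^(C·(k+2)^3) (log denoting the natural logarithm) such that for every star st-cut Z of G with |Z| ≤ k there exists A ∈ 𝒜 for which: A is compatible with Z; core_{G+A}(Z) is a minimum st-cut of G+A; and there exists a witnessing flow for Z in G+A. -/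
open scoped Classical

namespace FlowAug

variable {V : Type}

/-- Reachability from `a` to `b` using arcs in `A`. -/
def Reach (A : Set (V × V)) (a b : V) : Prop :=
  Relation.ReflTransGen (fun u v => (u, v) ∈ A) a b

/-- `Z` is an `st`-cut of the directed graph with arc set `E`. -/
def IsCut (E : Finset (V × V)) (s t : V) (Z : Finset (V × V)) : Prop :=
  Z ⊆ E ∧ ¬ Reach ((E : Set (V × V)) \ (Z : Set (V × V))) s t

/-- A minimal `st`-cut: no proper subset is an `st`-cut. -/
def IsMinimalCut (E : Finset (V × V)) (s t : V) (Z : Finset (V × V)) : Prop :=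
  IsCut E s t Z ∧ ∀ Z', Z' ⊂ Z → ¬ IsCut E s t Z'

/-- A minimum `st`-cut: of minimum cardinality among all `st`-cuts. -/
def IsMinCut (E : Finset (V × V)) (s t : V) (Z : Finset (V × V)) : Prop :=
  IsCut E s t Z ∧ ∀ Z', IsCut E s t Z' → Z.card ≤ Z'.card

/-- `Z ⊆ E` is an `st`-cut of the augmented graph `G + A`. -/
def IsCutAug (E A : Finset (V × V)) (s t : V) (Z : Finset (V × V)) : Prop :=
  Z ⊆ E ∧ ¬ Reach (((E : Set (V × V)) \ (Z : Set (V × V))) ∪ (A : Set (V × V))) s t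

/-- A minimum `st`-cut of the augmented graph `G + A`. -/
def IsMinCutAug (E A : Finset (V × V)) (s t : V) (Z : Finset (V × V)) : Prop :=
  IsCutAug E A s t Z ∧ ∀ Z', IsCutAug E A s t Z' → Z.card ≤ Z'.card

/-- The `s`-side of the cut `Z`: vertices reachable from `s` using arcs of `E \ Z`. -/
def sSide (E : Finset (V × V)) (s : V) (Z : Finset (V × V)) : Set V :=
  {v | Reach ((E : Set (V × V)) \ (Z : Set (V × V))) s v}

/-- A star `st`-cut: every arc of `Z` has tail in the `s`-side and head in the `t`-side. -/
def IsStarCut (E : Finset (V × V)) (s t : V) (Z : Finset (V × V)) : Prop :=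
  IsCut E s t Z ∧ ∀ e ∈ Z, e.1 ∈ sSide E s Z ∧ e.2 ∉ sSide E s Z

/-- `A` is compatible with the star `st`-cut `Z`: no arc of `A` goes from the
`s`-side of `Z` to the `t`-side of `Z`. -/
def Compatible (E : Finset (V × V)) (s : V) (Z A : Finset (V × V)) : Prop :=
  ∀ e ∈ A, e.1 ∈ sSide E s Z → e.2 ∈ sSide E s Z

/-- `core_{G+A}(Z)`: arcs of `Z` whose head reaches `t` via arcs of `(E \ Z) ∪ A`. -/
noncomputable def coreAug (E A Z : Finset (V × V)) (t : V) : Finset (V × V) :=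
  Z.filter (fun e =>
    Reach (((E : Set (V × V)) \ (Z : Set (V × V))) ∪ (A : Set (V × V))) e.2 t)

/-- `core(Z)`: arcs of `Z` whose head reaches `t` via arcs of `E \ Z`. -/
noncomputable def core (E Z : Finset (V × V)) (t : V) : Finset (V × V) :=
  Z.filter (fun e => Reach ((E : Set (V × V)) \ (Z : Set (V × V))) e.2 t)

/-- `δ⁺(X)`: arcs of `E` with tail in `X` and head outside `X`. -/
noncomputable def deltaPlus (E : Finset (V × V)) (X : Set V) : Finset (V × V) :=
  E.filter (fun e => e.1 ∈ X ∧ e.2 ∉ X)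

/-- The arcs traversed by a walk given by its list of vertices. -/
def arcsOf (p : List V) : List (V × V) := p.zip p.tail

/-- `p` is a directed path from `s` to `t` using arcs of `A`. -/
def IsPathIn (A : Set (V × V)) (s t : V) (p : List V) : Prop :=
  p.Chain' (fun u v => (u, v) ∈ A) ∧ p.head? = some s ∧ p.getLast? = some t

/-- The paths `P i` are pairwise arc-disjoint. -/
def ArcDisjoint {lam : ℕ} (P : Fin lam → List V) : Prop :=
  ∀ i j, i ≠ j → ∀ e : V × V, ¬ (e ∈ arcsOf (P i) ∧ e ∈ arcsOf (P j))

/-- An `st`-flow: a family of pairwise arc-disjoint directed `st`-paths in `G`. -/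
def IsFlow (E : Finset (V × V)) (s t : V) {lam : ℕ} (P : Fin lam → List V) : Prop :=
  (∀ i, IsPathIn (E : Set (V × V)) s t (P i)) ∧ ArcDisjoint P

/-- A maximum `st`-flow: the number of paths equals the minimum cardinality of an `st`-cut. -/
def IsMaxFlow (E : Finset (V × V)) (s t : V) {lam : ℕ} (P : Fin lam → List V) : Prop :=
  IsFlow E s t P ∧ ∃ Z, IsMinCut E s t Z ∧ Z.card = lam

/-- Arcs of the residual graph `G^P`. -/
def ResArc (E : Finset (V × V)) {lam : ℕ} (P : Fin lam → List V) (u v : V) : Prop :=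
  ((u, v) ∈ E ∧ ∀ i, (u, v) ∉ arcsOf (P i)) ∨ (∃ i, (v, u) ∈ arcsOf (P i))

/-- Reachability in the residual graph `G^P`. -/
def ResReach (E : Finset (V × V)) {lam : ℕ} (P : Fin lam → List V) : V → V → Prop :=
  Relation.ReflTransGen (ResArc E P)

/-- `G` has proper boundaries: `δ⁺({s})` and `δ⁻({t})` are minimum `st`-cuts
and there is no arc `(s, t)`. -/
def ProperBoundaries [DecidableEq V] (E : Finset (V × V)) (s t : V) : Prop :=
  IsMinCut E s t (E.filter (fun e => e.1 = s)) ∧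
  IsMinCut E s t (E.filter (fun e => e.2 = t)) ∧ (s, t) ∉ E

/-- The reachability pattern of `(G, P)` has only self-loops: no residual path
between internal vertices of distinct flow paths. -/
def OnlySelfLoops (E : Finset (V × V)) (s t : V) {lam : ℕ} (P : Fin lam → List V) : Prop :=
  ∀ i j : Fin lam, i ≠ j → ∀ u ∈ P i, u ≠ s → u ≠ t → ∀ v ∈ P j, v ≠ s → v ≠ t →
    ¬ ResReach E P u v

/-- A bottleneck arc: an arc contained in some minimum `st`-cut. -/
def Bottleneck (E : Finset (V × V)) (s t : V) (e : V × V) : Prop :=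
  ∃ Z, IsMinCut E s t Z ∧ e ∈ Z

/-- A witnessing flow for the star `st`-cut `Z` in `G + A`: `|core_{G+A}(Z)|`
`st`-paths in `G + A`, pairwise sharing no arc of `E \ A`, each containing
exactly one arc of `core_{G+A}(Z)` and no arc of `Z \ core_{G+A}(Z)`. -/
def WitnessingFlow (E A Z : Finset (V × V)) (s t : V) : Prop :=
  ∃ P : Fin (coreAug E A Z t).card → List V,
    (∀ i, IsPathIn ((E : Set (V × V)) ∪ (A : Set (V × V))) s t (P i)) ∧
    (∀ i j, i ≠ j → ∀ e : V × V, e ∈ arcsOf (P i) → e ∈ arcsOf (P j) →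
      e ∉ ((E : Set (V × V)) \ (A : Set (V × V)))) ∧
    (∀ i, ∃! e : V × V, e ∈ coreAug E A Z t ∧ e ∈ arcsOf (P i)) ∧
    (∀ i, ∀ e ∈ arcsOf (P i), e ∈ Z → e ∈ coreAug E A Z t)

/-- A reachable vertex is reached by a walk without repeated vertices. -/
lemma exists_injective_walk {r : V → V → Prop} {a b : V} (h : Relation.ReflTransGen r a b) :
    ∃ (n : ℕ) (p : ℕ → V), p 0 = a ∧ p n = b ∧ (∀ i < n, r (p i) (p (i + 1))) ∧
      ∀ i ≤ n, ∀ j ≤ n, p i = p j → i = j := by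
  have hex : ∃ n, ∃ p : ℕ → V, p 0 = a ∧ p n = b ∧ ∀ i < n, r (p i) (p (i + 1)) := by
    induction h with
    | refl => exact ⟨0, fun _ => a, rfl, rfl, by simp⟩
    | @tail c d _ hcd ih =>
      obtain ⟨n, p, h0, hn, hs⟩ := ih
      refine ⟨n + 1, fun i => if i ≤ n then p i else d, by simp [h0], by simp, fun i hi => ?_⟩
      rcases Nat.lt_succ_iff_lt_or_eq.mp hi with h | rfl
      · have h1 : i ≤ n := h.le
        have h2 : i + 1 ≤ n := h
        simpa [h1, h2] using hs i h
      · simpa [hn] using hcd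
  obtain ⟨p, h0, hn, hs⟩ := Nat.find_spec hex
  refine ⟨Nat.find hex, p, h0, hn, hs, ?_⟩
  set n := Nat.find hex with hndef
  have key : ∀ i j, i < j → j ≤ n → p i ≠ p j := by
    intro i j hij hj hp
    have hlt : n - (j - i) < n := by omega
    refine Nat.find_min hex hlt ⟨fun m => if m ≤ i then p m else p (m + (j - i)), by simp [h0],
      ?_, ?_⟩
    · by_cases hm : n - (j - i) ≤ i
      · have hjn : j = n := by omega
        simp only [hm, if_true]
        rw [show n - (j - i) = i by omega, hp, hjn, hn]
      · simp only [hm, if_false]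
        rw [show n - (j - i) + (j - i) = n by omega, hn]
    · intro m hm
      by_cases h1 : m + 1 ≤ i
      · simpa [h1, show m ≤ i by omega] using hs m (by omega)
      · by_cases h2 : m ≤ i
        · have : m = i := by omega
          subst this
          simp only [le_refl, if_true, h1, if_false]
          rw [hp, show m + 1 + (j - m) = j + 1 by omega]
          exact hs j (by omega)
        · simp only [h1, h2, if_false]
          rw [show m + 1 + (j - i) = m + (j - i) + 1 by omega]
          exact hs _ (by omega)
  intro i hi j hj hp
  rcases lt_trichotomy i j with h | h | h
  · exact (key i j h hj hp).elim
  · exact h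
  · exact (key j i h hi hp.symm).elim

/-- The contribution to a flow of a walk step from `x` to `y`: the arc `(x, y)` counted positively
or, for a backward step, the arc `(y, x)` counted negatively. -/
noncomputable def stepFlow (b : Prop) (x y : V) (e : V × V) : ℤ :=
  if b then (if (x, y) = e then 1 else 0) else -(if (y, x) = e then 1 else 0)

/-- The contribution to a flow of the first `n` steps of a walk, forward where `fw` holds. -/
noncomputable def walkFlow (fw : ℕ → Prop) (p : ℕ → V) (n : ℕ) (e : V × V) : ℤ :=
  ∑ i ∈ Finset.range n, stepFlow (fw i) (p i) (p (i + 1)) e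

/-- Net outflow at a vertex. -/
noncomputable def net [Fintype V] (f : V × V → ℤ) (u : V) : ℤ :=
  ∑ v, (f (u, v) - f (v, u))

/-- The divergence of a unit flow from `a` to `b`. -/
noncomputable def unitDiv (a b u : V) : ℤ := (if a = u then 1 else 0) - (if b = u then 1 else 0)

section net
variable [Fintype V]

lemma net_add (f g : V × V → ℤ) (u : V) : net (fun e => f e + g e) u = net f u + net g u := by
  simp only [net, ← Finset.sum_add_distrib]
  exact Finset.sum_congr rfl fun _ _ => by ring

lemma net_sub (f g : V × V → ℤ) (u : V) : net (fun e => f e - g e) u = net f u - net g u := by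
  simp only [net, ← Finset.sum_sub_distrib]
  exact Finset.sum_congr rfl fun _ _ => by ring

lemma net_sum {ι : Type*} (I : Finset ι) (f : ι → V × V → ℤ) (u : V) :
    net (fun e => ∑ i ∈ I, f i e) u = ∑ i ∈ I, net (f i) u := by
  simp only [net, ← Finset.sum_sub_distrib]
  rw [Finset.sum_comm]

lemma net_stepFlow (b : Prop) (x y u : V) : net (stepFlow b x y) u = unitDiv x y u := by
  have aux : ∀ x y : V, ∑ v, ((if (x, y) = (u, v) then (1 : ℤ) else 0) -
      (if (x, y) = (v, u) then 1 else 0)) = unitDiv x y u := by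
    intro x y
    rw [Finset.sum_sub_distrib]
    simp only [Prod.mk.injEq, unitDiv, ite_and]
    congr 1
    · by_cases h : x = u <;> simp [h]
    · simp
  by_cases hb : b
  · simp only [net, stepFlow, hb, if_true, aux]
  · have := aux y x
    simp only [net, stepFlow, hb, if_false]
    calc _ = -∑ v, ((if (y, x) = (u, v) then (1 : ℤ) else 0) -
        (if (y, x) = (v, u) then 1 else 0)) := by
          rw [← Finset.sum_neg_distrib]; exact Finset.sum_congr rfl fun _ _ => by ring
      _ = _ := by rw [this]; simp [unitDiv]

lemma net_walkFlow (fw : ℕ → Prop) (p : ℕ → V) (n : ℕ) (u : V) :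
    net (walkFlow fw p n) u = unitDiv (p 0) (p n) u := by
  have : net (walkFlow fw p n) u = ∑ i ∈ Finset.range n, unitDiv (p i) (p (i + 1)) u := by
    rw [Finset.sum_congr rfl fun i _ => (net_stepFlow (fw i) (p i) (p (i + 1)) u).symm]
    exact net_sum _ _ _
  rw [this]
  simp only [unitDiv]
  exact Finset.sum_range_sub' (fun i => if p i = u then (1 : ℤ) else 0) n

end net

lemma walkFlow_true (p : ℕ → V) (n : ℕ) (e : V × V) :
    walkFlow (fun _ => True) p n e =
      ∑ i ∈ Finset.range n, if (p i, p (i + 1)) = e then (1 : ℤ) else 0 := by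
  simp [walkFlow, stepFlow]

/-- Along a walk without repeated vertices every arc is used at most once. -/
lemma sum_indicator_le_one {p : ℕ → V} {n : ℕ} (hp : ∀ i ≤ n, ∀ j ≤ n, p i = p j → i = j)
    (Q : ℕ → Prop) (g : ℕ → V × V) (e : V × V) (hg : ∀ i j, g i = g j → p i = p j) :
    ∑ i ∈ Finset.range n, (if Q i ∧ g i = e then (1 : ℤ) else 0) ≤ 1 := by
  rw [Finset.sum_boole]
  norm_cast
  rw [Finset.card_le_one]
  intro a ha b hb
  simp only [Finset.mem_filter, Finset.mem_range] at ha hb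
  exact hp a ha.1.le b hb.1.le (hg a b (ha.2.2.trans hb.2.2.symm))

/-- A nonnegative integral flow of value `N` contains `N` walks. -/
lemma exists_walks_of_flow [Fintype V] {s t : V} (N : ℕ) :
    ∀ f : V × V → ℤ, (∀ e, 0 ≤ f e) → (∀ u, net f u = N * unitDiv s t u) →
    ∃ (n : Fin N → ℕ) (p : Fin N → ℕ → V), (∀ j, p j 0 = s) ∧ (∀ j, p j (n j) = t) ∧
      ∀ e, ∑ j, walkFlow (fun _ => True) (p j) (n j) e ≤ f e := by
  induction N with
  | zero => exact fun f hf _ => ⟨Fin.elim0, Fin.elim0, fun j => j.elim0, fun j => j.elim0,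
      fun e => by simpa using hf e⟩
  | succ N ih =>
    intro f hf hnet
    have hreach : Relation.ReflTransGen (fun u v => 0 < f (u, v)) s t := by
      by_contra hcon
      set X : Finset V := Finset.univ.filter
        (fun v => Relation.ReflTransGen (fun u v => 0 < f (u, v)) s v) with hX
      have hs : s ∈ X := by simp [hX, Relation.ReflTransGen.refl]
      have ht : t ∉ X := by simp [hX, hcon]
      have h1 : ∑ u ∈ X, net f u = N + 1 := by
        simp only [hnet, unitDiv]
        rw [← Finset.mul_sum, Finset.sum_sub_distrib]
        simp [hs, ht]
      have h2 : ∑ u ∈ X, net f u ≤ 0 := by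
        have e1 : ∀ u, net f u = ∑ v ∈ X, (f (u, v) - f (v, u)) +
            ∑ v ∈ Xᶜ, (f (u, v) - f (v, u)) := fun u => (Finset.sum_add_sum_compl X _).symm
        simp only [e1, Finset.sum_add_distrib]
        have e2 : ∑ u ∈ X, ∑ v ∈ X, (f (u, v) - f (v, u)) = 0 := by
          simp only [Finset.sum_sub_distrib]
          rw [Finset.sum_comm, sub_self]
        rw [e2, zero_add]
        refine Finset.sum_nonpos fun u hu => Finset.sum_nonpos fun v hv => ?_
        have h3 : f (u, v) ≤ 0 := by
          by_contra h
          rw [Finset.mem_compl] at hv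
          simp only [hX, Finset.mem_filter, Finset.mem_univ, true_and] at hu hv
          exact hv (hu.tail (not_le.mp h))
        have := hf (v, u)
        omega
      omega
    obtain ⟨n₀, p₀, h0, hn, hs, hinj⟩ := exists_injective_walk hreach
    have hle : ∀ e, walkFlow (fun _ => True) p₀ n₀ e ≤ f e := by
      intro e
      rw [walkFlow_true]
      by_cases he : ∃ i < n₀, (p₀ i, p₀ (i + 1)) = e
      · obtain ⟨i, hi, rfl⟩ := he
        have := sum_indicator_le_one hinj (fun _ => True) (fun i => (p₀ i, p₀ (i + 1)))
          (p₀ i, p₀ (i + 1)) (fun a b h => (Prod.mk.inj h).1)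
        simp only [true_and] at this
        exact this.trans (hs i hi)
      · rw [Finset.sum_eq_zero]
        · exact hf e
        · intro i hi
          rw [if_neg fun h => he ⟨i, Finset.mem_range.mp hi, h⟩]
    obtain ⟨n, p, g0, gn, gs⟩ := ih (fun e => f e - walkFlow (fun _ => True) p₀ n₀ e)
      (fun e => sub_nonneg.mpr (hle e)) (fun u => by
        rw [net_sub, hnet, net_walkFlow, h0, hn]; push_cast; ring)
    refine ⟨Fin.cons n₀ n, Fin.cons p₀ p, ?_, ?_, ?_⟩
    · intro j; refine Fin.cases ?_ (fun j => ?_) j <;> simp [h0, g0]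
    · intro j; refine Fin.cases ?_ (fun j => ?_) j <;> simp [hn, gn]
    · intro e
      have := gs e
      rw [Fin.sum_univ_succ]
      simp only [Fin.cons_zero, Fin.cons_succ]
      omega

/-- A flow of `lam` walks of length at most `L` in `G + A`, padded with loops at `t`, pairwise
(and internally) sharing no arc outside `A`. All loops are assumed to lie in `A`. -/
structure AugFlow (E A : Finset (V × V)) (s t : V) (lam L : ℕ) (P : Fin lam → ℕ → V) : Prop where
  loop : ∀ v, (v, v) ∈ A
  start : ∀ j, P j 0 = s
  finish : ∀ j l, L ≤ l → P j l = t
  arc : ∀ j l, (P j l, P j (l + 1)) ∈ E ∨ (P j l, P j (l + 1)) ∈ A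
  inj : ∀ j l j' l', (P j l, P j (l + 1)) = (P j' l', P j' (l' + 1)) →
    (P j l, P j (l + 1)) ∉ A → j = j' ∧ l = l'

/-- Arcs of the residual graph of a flow in `G + A`, usable without cancelling flow. -/
def FreeArc (E A : Finset (V × V)) {lam : ℕ} (P : Fin lam → ℕ → V) (u v : V) : Prop :=
  (u, v) ∈ A ∨ (u, v) ∈ E ∧ ∀ j l, (P j l, P j (l + 1)) ≠ (u, v)

/-- Arcs of the residual graph of a flow in `G + A`. -/
def AugRes (E A : Finset (V × V)) {lam : ℕ} (P : Fin lam → ℕ → V) (u v : V) : Prop :=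
  FreeArc E A P u v ∨ ∃ j l, P j l = v ∧ P j (l + 1) = u

/-- Reachability in the residual graph of a flow in `G + A`. -/
abbrev AugReach (E A : Finset (V × V)) {lam : ℕ} (P : Fin lam → ℕ → V) : V → V → Prop :=
  Relation.ReflTransGen (AugRes E A P)

section
variable {E A A' : Finset (V × V)} {s t : V} {lam L : ℕ} {P : Fin lam → ℕ → V}

lemma AugReach.mono (h : A ⊆ A') {u v : V} (huv : AugReach E A P u v) : AugReach E A' P u v :=
  Relation.ReflTransGen.mono (r := AugRes E A P) (p := AugRes E A' P)
    (fun _ _ hab => Or.imp (fun h' => Or.imp (fun h'' => h h'') id h') id hab) _ _ huv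

lemma AugFlow.mono (hP : AugFlow E A s t lam L P) (h : A ⊆ A') : AugFlow E A' s t lam L P where
  loop v := h (hP.loop v)
  start := hP.start
  finish := hP.finish
  arc j l := (hP.arc j l).imp id fun h' => h h'
  inj j l j' l' he hA := hP.inj j l j' l' he fun h' => hA (h h')

lemma augReach_backward (j : Fin lam) {l l' : ℕ} (h : l ≤ l') :
    AugReach E A P (P j l') (P j l) := by
  induction h with
  | refl => exact .refl
  | step _ ih => exact .head (Or.inr ⟨j, _, rfl, rfl⟩) ih

lemma AugFlow.reach_from_t (hP : AugFlow E A s t lam L P) (j : Fin lam) (l : ℕ) :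
    AugReach E A P t (P j l) := by
  have := augReach_backward (E := E) (A := A) (P := P) j (le_max_left l L)
  rwa [hP.finish j _ (le_max_right l L)] at this

/-- The flow function of a flow in `G + A` uses every arc outside `A` at most once. -/
lemma AugFlow.sum_le_one (hP : AugFlow E A s t lam L P) {e : V × V} (he : e ∉ A) :
    ∑ j, walkFlow (fun _ => True) (P j) L e ≤ 1 := by
  simp only [walkFlow_true]
  rw [← Finset.sum_product', Finset.sum_boole]
  norm_cast
  rw [Finset.card_le_one]
  intro a ha b hb
  simp only [Finset.mem_filter, Finset.mem_product, Finset.mem_range] at ha hb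
  obtain ⟨h1, h2⟩ := hP.inj _ _ _ _ (ha.2.trans hb.2.symm) (ha.2 ▸ he)
  exact Prod.ext h1 h2

lemma walkFlow_true_nonneg (p : ℕ → V) (n : ℕ) (e : V × V) :
    0 ≤ walkFlow (fun _ => True) p n e := by
  rw [walkFlow_true]
  exact Finset.sum_nonneg fun _ _ => by split_ifs <;> norm_num

/-- A flow can be augmented along a residual walk from `s` to `t`. -/
lemma AugFlow.augment [Fintype V] (hP : AugFlow E A s t lam L P) (hr : AugReach E A P s t) :
    ∃ (L' : ℕ) (P' : Fin (lam + 1) → ℕ → V), AugFlow E A s t (lam + 1) L' P' := by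
  obtain ⟨n, p, h0, hn, hs, hinj⟩ := exists_injective_walk hr
  set fw : ℕ → Prop := fun i => FreeArc E A P (p i) (p (i + 1)) with hfw
  set f₀ : V × V → ℤ := fun e => ∑ j, walkFlow (fun _ => True) (P j) L e with hf₀
  have f₀_nonneg : ∀ e, 0 ≤ f₀ e := fun e => Finset.sum_nonneg fun j _ => walkFlow_true_nonneg _ _ _
  have f₀_pos : ∀ j l, l < L → 1 ≤ f₀ (P j l, P j (l + 1)) := by
    intro j l hl
    have h1 : 1 ≤ walkFlow (fun _ => True) (P j) L (P j l, P j (l + 1)) := by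
      rw [walkFlow_true]
      refine le_trans ?_ (Finset.single_le_sum (f := fun i => if (P j i, P j (i + 1)) =
        (P j l, P j (l + 1)) then (1 : ℤ) else 0) (fun i _ => by split_ifs <;> norm_num)
        (Finset.mem_range.mpr hl))
      simp
    exact h1.trans (Finset.single_le_sum (f := fun j' => walkFlow (fun _ => True) (P j') L
      (P j l, P j (l + 1))) (fun _ _ => walkFlow_true_nonneg _ _ _) (Finset.mem_univ j))
  have f₀_zero : ∀ e, (∀ j l, (P j l, P j (l + 1)) ≠ e) → f₀ e = 0 := fun e he =>
    Finset.sum_eq_zero fun j _ => by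
      rw [walkFlow_true]; exact Finset.sum_eq_zero fun l _ => if_neg (he j l)
  set up : V × V → ℤ := fun e =>
    ∑ i ∈ Finset.range n, (if fw i ∧ (p i, p (i + 1)) = e then (1 : ℤ) else 0) with hup
  set dn : V × V → ℤ := fun e =>
    ∑ i ∈ Finset.range n, (if ¬ fw i ∧ (p (i + 1), p i) = e then (1 : ℤ) else 0) with hdn
  have hw : ∀ e, walkFlow fw p n e = up e - dn e := by
    intro e
    simp only [walkFlow, hup, hdn, ← Finset.sum_sub_distrib]
    refine Finset.sum_congr rfl fun i _ => ?_
    by_cases h : fw i <;> simp [stepFlow, h]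
  have up_nonneg : ∀ e, 0 ≤ up e := fun e =>
    Finset.sum_nonneg fun _ _ => by split_ifs <;> norm_num
  have dn_nonneg : ∀ e, 0 ≤ dn e := fun e =>
    Finset.sum_nonneg fun _ _ => by split_ifs <;> norm_num
  have up_le : ∀ e, up e ≤ 1 := fun e =>
    sum_indicator_le_one hinj fw _ e fun a b h => (Prod.mk.inj h).1
  have dn_le : ∀ e, dn e ≤ 1 := fun e => by
    convert sum_indicator_le_one hinj (fun i => ¬ fw i) (fun i => (p (i + 1), p i)) e
      fun a b h => (Prod.mk.inj h).2
  have up_pos : ∀ e, 0 < up e → FreeArc E A P e.1 e.2 := by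
    intro e he
    obtain ⟨i, -, hi⟩ := Finset.exists_ne_zero_of_sum_ne_zero he.ne'
    have hi' : fw i ∧ (p i, p (i + 1)) = e := by by_contra h; exact hi (if_neg h)
    obtain ⟨h1, rfl⟩ := hi'
    exact h1
  have dn_pos : ∀ e, 0 < dn e → 1 ≤ f₀ e := by
    intro e he
    obtain ⟨i, hin, hi⟩ := Finset.exists_ne_zero_of_sum_ne_zero he.ne'
    have hi' : ¬ fw i ∧ (p (i + 1), p i) = e := by by_contra h; exact hi (if_neg h)
    obtain ⟨h1, rfl⟩ := hi'
    rcases hs i (Finset.mem_range.mp hin) with h | ⟨j, l, hj, hj'⟩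
    · exact (h1 h).elim
    · by_cases hl : l < L
      · rw [← hj, ← hj']
        exact f₀_pos j l hl
      · refine (h1 (Or.inl ?_)).elim
        rw [← hj, ← hj', hP.finish j l (not_lt.mp hl), hP.finish j (l + 1) (by omega)]
        exact hP.loop t
  set f₁ : V × V → ℤ := fun e => f₀ e + walkFlow fw p n e with hf₁
  have f₁_nonneg : ∀ e, 0 ≤ f₁ e := by
    intro e
    simp only [hf₁, hw]
    have h1 := f₀_nonneg e
    have h2 := up_nonneg e
    have h3 := dn_le e
    have h4 := dn_pos e
    by_cases h5 : 0 < dn e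
    · have := h4 h5; omega
    · omega
  have f₁_le : ∀ e, e ∉ A → f₁ e ≤ if e ∈ E then 1 else 0 := by
    intro e he
    simp only [hf₁, hw]
    have h3 := dn_nonneg e
    have h4 := up_le e
    by_cases hup0 : 0 < up e
    · obtain ⟨hE, hun⟩ := (up_pos e hup0).resolve_left he
      have := f₀_zero e hun
      rw [if_pos hE]; omega
    · by_cases hE : e ∈ E
      · have := hP.sum_le_one he
        rw [if_pos hE]
        have h5 : f₀ e ≤ 1 := this
        omega
      · have : f₀ e = 0 := f₀_zero e fun j l h => by
          rcases hP.arc j l with h' | h' <;> rw [h] at h'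
          exacts [hE h', he h']
        rw [if_neg hE]; omega
  have f₁_net : ∀ u, net f₁ u = ((lam + 1 : ℕ) : ℤ) * unitDiv s t u := by
    intro u
    rw [hf₁, net_add, net_walkFlow, h0, hn, hf₀, net_sum]
    simp only [net_walkFlow, hP.start, hP.finish _ L le_rfl]
    simp only [Finset.sum_const, Finset.card_univ, Fintype.card_fin]
    push_cast; ring
  obtain ⟨m, q, q0, qm, hq⟩ := exists_walks_of_flow (lam + 1) f₁ f₁_nonneg f₁_net
  have arc_eq : ∀ j l, l < m j → ((fun j l => if l < m j then q j l else t) j l,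
      (fun j l => if l < m j then q j l else t) j (l + 1)) = (q j l, q j (l + 1)) := by
    intro j l hl
    simp only [hl, if_true]
    rcases Nat.lt_or_ge (l + 1) (m j) with h | h
    · simp [h]
    · have : l + 1 = m j := by omega
      simp [this, qm]
  have arc_ge : ∀ j l, m j ≤ l → ((fun j l => if l < m j then q j l else t) j l,
      (fun j l => if l < m j then q j l else t) j (l + 1)) = (t, t) := by
    intro j l hl
    simp [not_lt.mpr hl, not_lt.mpr (hl.trans l.le_succ)]
  have hcnt : ∀ e, ((((Finset.univ : Finset (Fin (lam + 1))).sigma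
      (fun j => Finset.range (m j))).filter
        (fun a => (q a.1 a.2, q a.1 (a.2 + 1)) = e)).card : ℤ) ≤ f₁ e := by
    intro e
    refine le_trans (le_of_eq ?_) (hq e)
    simp only [walkFlow_true]
    rw [Finset.sum_sigma', Finset.sum_boole]
  refine ⟨Finset.univ.sup m, fun j l => if l < m j then q j l else t, hP.loop, ?_, ?_, ?_, ?_⟩
  · intro j
    by_cases h : 0 < m j
    · simp [h, q0]
    · have : m j = 0 := by omega
      simp only [this, lt_irrefl, if_false]
      rw [← qm j, this, q0]
  · intro j l hl
    have : m j ≤ l := (Finset.le_sup (f := m) (Finset.mem_univ j)).trans hl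
    simp [not_lt.mpr this]
  · intro j l
    rcases Nat.lt_or_ge l (m j) with h | h
    · have h1 := arc_eq j l h
      simp only at h1
      rw [h1]
      by_contra hcon
      push Not at hcon
      have h2 := hcnt (q j l, q j (l + 1))
      have h3 := f₁_le _ hcon.2
      rw [if_neg hcon.1] at h3
      have h4 : 0 < (((Finset.univ : Finset (Fin (lam + 1))).sigma
          (fun j => Finset.range (m j))).filter
          (fun a => (q a.1 a.2, q a.1 (a.2 + 1)) = (q j l, q j (l + 1)))).card :=
        Finset.card_pos.mpr ⟨⟨j, l⟩, by simp [h]⟩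
      omega
    · have h1 := arc_ge j l h
      simp only at h1
      rw [h1]
      exact Or.inr (hP.loop t)
  · intro j l j' l' he hA
    have hl : l < m j := by
      by_contra h
      have h1 := arc_ge j l (not_lt.mp h)
      simp only at h1
      rw [h1] at hA
      exact hA (hP.loop t)
    have hl' : l' < m j' := by
      by_contra h
      have h1 := arc_ge j' l' (not_lt.mp h)
      simp only at h1
      rw [he, h1] at hA
      exact hA (hP.loop t)
    have h1 := arc_eq j l hl
    have h1' := arc_eq j' l' hl'
    simp only at h1 h1'
    rw [h1, h1'] at he
    rw [h1] at hA
    have h2 := hcnt (q j l, q j (l + 1))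
    have h3 := f₁_le _ hA
    have h4 : (((Finset.univ : Finset (Fin (lam + 1))).sigma
          (fun j => Finset.range (m j))).filter
          (fun a => (q a.1 a.2, q a.1 (a.2 + 1)) = (q j l, q j (l + 1)))).card ≤ 1 := by
      split_ifs at h3 <;> omega
    have h5 := Finset.card_le_one.mp h4 ⟨j, l⟩ (by simp [hl]) ⟨j', l'⟩ (by simp [hl', he])
    simp only [Sigma.mk.injEq, heq_eq_eq] at h5
    exact h5
end

/-- A predicate that holds at `a` and fails at `b` fails for the first time in between. -/
lemma exists_switch {Q : ℕ → Prop} {a b : ℕ} (hab : a ≤ b) (ha : Q a) (hb : ¬ Q b) :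
    ∃ m, a ≤ m ∧ m < b ∧ (∀ i, a ≤ i → i ≤ m → Q i) ∧ ¬ Q (m + 1) := by
  have hex : ∃ m, a ≤ m ∧ ¬ Q m := ⟨b, hab, hb⟩
  obtain ⟨h1, h2⟩ := Nat.find_spec hex
  have h3 : Nat.find hex ≠ a := fun h => by rw [h] at h2; exact h2 ha
  have h4 : Nat.find hex ≤ b := Nat.find_min' hex ⟨hab, hb⟩
  refine ⟨Nat.find hex - 1, by omega, by omega, fun i hi hi' => ?_, ?_⟩
  · by_contra h
    exact Nat.find_min hex (by omega) ⟨hi, h⟩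
  · rwa [Nat.sub_add_cancel (by omega)]

/-- A predicate that holds at `a` and fails from `b` on has a last place where it holds. -/
lemma exists_last {Q : ℕ → Prop} {a b : ℕ} (ha : Q a) (hb : ∀ l, b ≤ l → ¬ Q l) :
    ∃ m, a ≤ m ∧ Q m ∧ ∀ l, m < l → ¬ Q l := by
  have hbd : ∀ l, Q l → l ≤ b := fun l hl => by
    by_contra h
    exact hb l (by omega) hl
  refine ⟨Nat.findGreatest Q b, Nat.le_findGreatest (hbd a ha) ha,
    Nat.findGreatest_spec (hbd a ha) ha, fun l hl hQ => ?_⟩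
  exact Nat.findGreatest_is_greatest hl (hbd l hQ) hQ

/-- `S` is a vertex set containing `s` but not `t`, left by no arc of `A`, and left only by those
arcs of `E` that lie in `Z`. -/
structure Separates (E A Z : Finset (V × V)) (s t : V) (S : Set V) : Prop where
  source : s ∈ S
  sink : t ∉ S
  closed : ∀ e ∈ A, e.1 ∈ S → e.2 ∈ S
  cut : ∀ e ∈ E, e.1 ∈ S → e.2 ∉ S → e ∈ Z

/-- Positions at which a flow leaves `S`. -/
noncomputable def crossings {lam : ℕ} (P : Fin lam → ℕ → V) (L : ℕ) (S : Set V) :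
    Finset (Fin lam × ℕ) :=
  (Finset.univ ×ˢ Finset.range L).filter (fun a => P a.1 a.2 ∈ S ∧ P a.1 (a.2 + 1) ∉ S)

/-- Positions at which a flow enters `S`. -/
noncomputable def entries {lam : ℕ} (P : Fin lam → ℕ → V) (L : ℕ) (S : Set V) :
    Finset (Fin lam × ℕ) :=
  (Finset.univ ×ˢ Finset.range L).filter (fun a => P a.1 a.2 ∉ S ∧ P a.1 (a.2 + 1) ∈ S)

section
variable {E A Z : Finset (V × V)} {s t : V} {lam L : ℕ} {P : Fin lam → ℕ → V} {S : Set V}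

lemma AugFlow.lt_of_mem (hP : AugFlow E A s t lam L P) (hS : t ∉ S) {j : Fin lam} {l : ℕ}
    (h : P j l ∈ S) : l < L := by
  by_contra hl
  rw [hP.finish j l (not_lt.mp hl)] at h
  exact hS h

lemma AugFlow.mem_crossings (hP : AugFlow E A s t lam L P) (hS : t ∉ S) {a : Fin lam × ℕ} :
    a ∈ crossings P L S ↔ P a.1 a.2 ∈ S ∧ P a.1 (a.2 + 1) ∉ S := by
  simp only [crossings, Finset.mem_filter, Finset.mem_product, Finset.mem_univ, true_and,
    Finset.mem_range, and_iff_right_iff_imp]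
  exact fun h => hP.lt_of_mem hS h.1

lemma AugFlow.mem_entries (hP : AugFlow E A s t lam L P) (hS : t ∉ S) {a : Fin lam × ℕ} :
    a ∈ entries P L S ↔ P a.1 a.2 ∉ S ∧ P a.1 (a.2 + 1) ∈ S := by
  simp only [entries, Finset.mem_filter, Finset.mem_product, Finset.mem_univ, true_and,
    Finset.mem_range, and_iff_right_iff_imp]
  exact fun h => (Nat.lt_succ_self _).trans (hP.lt_of_mem hS h.2)

lemma AugFlow.crossing_mem (hP : AugFlow E A s t lam L P) (hS : Separates E A Z s t S)
    {j : Fin lam} {l : ℕ} (h : P j l ∈ S) (h' : P j (l + 1) ∉ S) :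
    (P j l, P j (l + 1)) ∉ A ∧ (P j l, P j (l + 1)) ∈ Z := by
  have hA : (P j l, P j (l + 1)) ∉ A := fun hA => h' (hS.closed _ hA h)
  exact ⟨hA, hS.cut _ ((hP.arc j l).resolve_right hA) h h'⟩

lemma AugFlow.card_crossings_le (hP : AugFlow E A s t lam L P) (hS : Separates E A Z s t S) :
    (crossings P L S).card ≤ Z.card := by
  refine Finset.card_le_card_of_injOn (fun a => (P a.1 a.2, P a.1 (a.2 + 1))) ?_ ?_
  · intro a ha
    have := (hP.mem_crossings hS.sink).mp ha
    exact (hP.crossing_mem hS this.1 this.2).2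
  · intro a ha b hb hab
    have := (hP.mem_crossings hS.sink).mp ha
    have := hP.inj _ _ _ _ hab (hP.crossing_mem hS this.1 this.2).1
    exact Prod.ext this.1 this.2

lemma AugFlow.exists_first_exit (hP : AugFlow E A s t lam L P) (hS : Separates E A Z s t S) :
    ∃ a : Fin lam → ℕ, ∀ j, (∀ l ≤ a j, P j l ∈ S) ∧ P j (a j + 1) ∉ S := by
  have : ∀ j, ∃ m, (∀ l ≤ m, P j l ∈ S) ∧ P j (m + 1) ∉ S := by
    intro j
    have h0 : P j 0 ∈ S := by rw [hP.start]; exact hS.source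
    have hL : P j L ∉ S := by rw [hP.finish j L le_rfl]; exact hS.sink
    obtain ⟨m, -, -, h1, h2⟩ := exists_switch (Q := fun l => P j l ∈ S) (Nat.zero_le L) h0 hL
    exact ⟨m, fun l hl => h1 l l.zero_le hl, h2⟩
  choose a ha using this
  exact ⟨a, ha⟩

lemma AugFlow.exists_last_exit (hP : AugFlow E A s t lam L P) (hS : Separates E A Z s t S) :
    ∃ b : Fin lam → ℕ, ∀ j, P j (b j) ∈ S ∧ ∀ l, b j < l → P j l ∉ S := by
  have : ∀ j, ∃ m, P j m ∈ S ∧ ∀ l, m < l → P j l ∉ S := by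
    intro j
    have h0 : P j 0 ∈ S := by rw [hP.start]; exact hS.source
    obtain ⟨m, -, h1, h2⟩ := exists_last (Q := fun l => P j l ∈ S) (b := L) h0
      fun l hl => by rw [hP.finish j l hl]; exact hS.sink
    exact ⟨m, h1, h2⟩
  choose b hb using this
  exact ⟨b, hb⟩

lemma AugFlow.le_card_crossings (hP : AugFlow E A s t lam L P) (hS : Separates E A Z s t S) :
    lam ≤ (crossings P L S).card := by
  obtain ⟨a, ha⟩ := hP.exists_first_exit hS
  have := Finset.card_le_card_of_injOn (s := (Finset.univ : Finset (Fin lam)))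
    (t := crossings P L S) (fun j => (j, a j))
    (fun j _ => (hP.mem_crossings hS.sink).mpr ⟨(ha j).1 _ le_rfl, (ha j).2⟩)
    (fun i _ j _ h => (Prod.mk.inj h).1)
  simpa using this

/-- A flow enters `S` at most as often as it leaves `S`. -/
lemma AugFlow.card_entries_le (hP : AugFlow E A s t lam L P) (hS : t ∉ S) :
    (entries P L S).card ≤ (crossings P L S).card := by
  have h : ∀ a : Fin lam × ℕ, a ∈ entries P L S → ∃ m, a.2 + 1 ≤ m ∧
      (∀ i, a.2 + 1 ≤ i → i ≤ m → P a.1 i ∈ S) ∧ P a.1 (m + 1) ∉ S := by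
    intro a ha
    obtain ⟨-, h2⟩ := (hP.mem_entries hS).mp ha
    have hL : P a.1 L ∉ S := by rw [hP.finish a.1 L le_rfl]; exact hS
    obtain ⟨m, h3, -, h4⟩ := exists_switch (Q := fun l => P a.1 l ∈ S)
      (hP.lt_of_mem hS h2).le h2 hL
    exact ⟨m, h3, h4⟩
  choose! m hm using h
  refine Finset.card_le_card_of_injOn (fun a => (a.1, m a)) ?_ ?_
  · intro a ha
    obtain ⟨h1, h2, h3⟩ := hm a ha
    exact (hP.mem_crossings hS).mpr ⟨h2 _ h1 le_rfl, h3⟩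
  · rintro ⟨i, a⟩ ha ⟨j, b⟩ hb hab
    obtain ⟨rfl, hab⟩ := Prod.mk.inj hab
    simp only at hab
    obtain ⟨h1, h2, -⟩ := hm _ ha
    obtain ⟨h1', h2', -⟩ := hm _ hb
    have ga := ((hP.mem_entries hS).mp ha).1
    have gb := ((hP.mem_entries hS).mp hb).1
    simp only at h1 h2 h1' h2' ga gb
    rcases lt_trichotomy a b with h | h | h
    · exact (gb (h2 b h (by omega))).elim
    · rw [h]
    · exact (ga (h2' a h (by omega))).elim

/-- First position of the `j`-th walk from which `v` is reachable in the residual graph. -/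
noncomputable def firstReach (E A : Finset (V × V)) {lam : ℕ} (P : Fin lam → ℕ → V) (j : Fin lam)
    (v : V) : ℕ :=
  sInf {m | AugReach E A P (P j m) v}

lemma AugFlow.firstReach_spec (hP : AugFlow E A s t lam L P) (i j : Fin lam) (l : ℕ) :
    AugReach E A P (P i (firstReach E A P i (P j l))) (P j l) :=
  Nat.sInf_mem (s := {m | AugReach E A P (P i m) (P j l)})
    ⟨L, by
      change AugReach E A P (P i L) (P j l)
      rw [hP.finish i L le_rfl]; exact hP.reach_from_t j l⟩

lemma AugFlow.firstReach_le_iff (hP : AugFlow E A s t lam L P) {i j : Fin lam} {l m : ℕ} :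
    firstReach E A P i (P j l) ≤ m ↔ AugReach E A P (P i m) (P j l) :=
  ⟨fun h => (augReach_backward i h).trans (hP.firstReach_spec i j l), fun h => Nat.sInf_le h⟩

lemma AugFlow.firstReach_mono (hP : AugFlow E A s t lam L P) (i j : Fin lam) {l l' : ℕ}
    (h : l ≤ l') : firstReach E A P i (P j l) ≤ firstReach E A P i (P j l') :=
  hP.firstReach_le_iff.mpr ((hP.firstReach_spec i j l').trans (augReach_backward j h))

/-- Arcs that connect each position `l` of the `j`-th walk to the first position of the `i`-th
walk from which position `l + 1` is reachable. -/
noncomputable def liftArcs (E A : Finset (V × V)) {lam : ℕ} (P : Fin lam → ℕ → V) (L : ℕ)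
    (i j : Fin lam) : Finset (V × V) :=
  A ∪ (Finset.range L).image (fun l => (P j l, P i (firstReach E A P i (P j (l + 1)))))

/-- Adding the arcs `liftArcs` increases the flow value. -/
lemma AugFlow.exists_liftArcs [Fintype V] (hP : AugFlow E A s t lam L P) (i j : Fin lam) :
    ∃ (L' : ℕ) (P' : Fin (lam + 1) → ℕ → V),
      AugFlow E (liftArcs E A P L i j) s t (lam + 1) L' P' := by
  have hsub : A ⊆ liftArcs E A P L i j := Finset.subset_union_left
  refine (hP.mono hsub).augment ?_
  have : ∀ l ≤ L, AugReach E (liftArcs E A P L i j) P s (P j l) := by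
    intro l
    induction l with
    | zero => intro _; rw [hP.start]
    | succ l ih =>
      intro hl
      refine ((ih (by omega)).tail (Or.inl (Or.inl ?_))).trans
        (AugReach.mono hsub (hP.firstReach_spec i j (l + 1)))
      exact Finset.mem_union_right _ (Finset.mem_image.mpr ⟨l, Finset.mem_range.mpr hl, rfl⟩)
  simpa [hP.finish j L le_rfl] using this L le_rfl

lemma AugFlow.liftArcs_separates (hP : AugFlow E A s t lam L P) (hS : Separates E A Z s t S)
    {i j : Fin lam} {a b : ℕ} (ha : ∀ l ≤ a, P i l ∈ S) (hb : ∀ l, b < l → P j l ∉ S)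
    (hr : AugReach E A P (P i a) (P j (b + 1))) : Separates E (liftArcs E A P L i j) Z s t S where
  source := hS.source
  sink := hS.sink
  cut := hS.cut
  closed e he h := by
    rcases Finset.mem_union.mp he with he | he
    · exact hS.closed e he h
    · obtain ⟨l, -, rfl⟩ := Finset.mem_image.mp he
      have hl : l ≤ b := by
        by_contra hl
        exact hb l (not_le.mp hl) h
      exact ha _ ((hP.firstReach_mono i j (by omega)).trans (hP.firstReach_le_iff.mpr hr))

end

/-- Position `l` is deleted when both it and its successor are marked by `c ∈ F`. -/
def Deleted (c : ℕ → V) (L : ℕ) (F : Finset V) (l : ℕ) : Prop :=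
  1 ≤ l ∧ l < L ∧ c l ∈ F ∧ c (l + 1) ∈ F

/-- The first position from `l` on that is not deleted. -/
noncomputable def nextKept (c : ℕ → V) (L : ℕ) (F : Finset V) (l : ℕ) : ℕ :=
  sInf {m | l ≤ m ∧ ¬ Deleted c L F m}

section
variable {c : ℕ → V} {L : ℕ} {F : Finset V} {l : ℕ}

lemma nextKept_spec (c : ℕ → V) (L : ℕ) (F : Finset V) (l : ℕ) :
    l ≤ nextKept c L F l ∧ ¬ Deleted c L F (nextKept c L F l) :=
  Nat.sInf_mem (s := {m | l ≤ m ∧ ¬ Deleted c L F m})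
    ⟨max l L, le_max_left _ _, fun h => absurd h.2.1 (by simp)⟩

lemma nextKept_le {m : ℕ} (h : l ≤ m) (h' : ¬ Deleted c L F m) : nextKept c L F l ≤ m :=
  Nat.sInf_le (s := {m | l ≤ m ∧ ¬ Deleted c L F m}) ⟨h, h'⟩

lemma nextKept_of_not_deleted (h : ¬ Deleted c L F l) : nextKept c L F l = l :=
  le_antisymm (nextKept_le le_rfl h) (nextKept_spec c L F l).1

lemma deleted_of_lt_nextKept {m : ℕ} (h : l ≤ m) (h' : m < nextKept c L F l) :
    Deleted c L F m := by
  by_contra hm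
  exact absurd (nextKept_le h hm) (not_le.mpr h')

lemma nextKept_of_deleted (h : Deleted c L F l) :
    nextKept c L F l = nextKept c L F (l + 1) := by
  have h1 := nextKept_spec c L F l
  have h2 := nextKept_spec c L F (l + 1)
  have h3 : nextKept c L F l ≠ l := fun h' => h1.2 (by rwa [h'])
  exact le_antisymm (nextKept_le (by omega) h2.2) (nextKept_le (by omega) h1.2)
end

/-- Arcs that jump over the deleted positions of the `j`-th walk. -/
noncomputable def skipArcs (A : Finset (V × V)) {lam : ℕ} (P : Fin lam → ℕ → V) (L : ℕ)
    (j : Fin lam) (c : ℕ → V) (F : Finset V) : Finset (V × V) :=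
  A ∪ ((Finset.range L).filter (fun l => Deleted c L F (l + 1))).image
    (fun l => (P j l, P j (nextKept c L F (l + 1))))

/-- The flow in which the `j`-th walk jumps over its deleted positions. -/
noncomputable def skipWalk {lam : ℕ} (P : Fin lam → ℕ → V) (L : ℕ) (j : Fin lam) (c : ℕ → V)
    (F : Finset V) : Fin lam → ℕ → V :=
  Function.update P j (fun l => P j (nextKept c L F l))

section
variable {E A Z : Finset (V × V)} {s t : V} {lam L : ℕ} {P : Fin lam → ℕ → V} {S : Set V}

lemma AugFlow.skip_arc (hP : AugFlow E A s t lam L P) (j : Fin lam) (c : ℕ → V) (F : Finset V)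
    (i : Fin lam) (l : ℕ) :
    (skipWalk P L j c F i l, skipWalk P L j c F i (l + 1)) ∈ skipArcs A P L j c F ∨
      (skipWalk P L j c F i l, skipWalk P L j c F i (l + 1)) = (P i l, P i (l + 1)) := by
  by_cases hij : i = j
  · subst hij
    simp only [skipWalk, Function.update_self]
    by_cases h : Deleted c L F l
    · rw [nextKept_of_deleted h]
      exact Or.inl (Finset.mem_union_left _ (hP.loop _))
    · rw [nextKept_of_not_deleted h]
      by_cases h' : Deleted c L F (l + 1)
      · refine Or.inl (Finset.mem_union_right _ (Finset.mem_image.mpr ⟨l, ?_, rfl⟩))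
        have := h'.2.1
        exact Finset.mem_filter.mpr ⟨Finset.mem_range.mpr (by omega), h'⟩
      · rw [nextKept_of_not_deleted h']
        exact Or.inr rfl
  · simp [skipWalk, Function.update_of_ne hij]

lemma AugFlow.skip (hP : AugFlow E A s t lam L P) (j : Fin lam) (c : ℕ → V) (F : Finset V) :
    AugFlow E (skipArcs A P L j c F) s t lam L (skipWalk P L j c F) where
  loop v := Finset.mem_union_left _ (hP.loop v)
  start i := by
    by_cases hij : i = j
    · subst hij
      simp only [skipWalk, Function.update_self]
      rw [nextKept_of_not_deleted fun h => by simpa using h.1, hP.start]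
    · simp [skipWalk, Function.update_of_ne hij, hP.start]
  finish i l hl := by
    by_cases hij : i = j
    · subst hij
      simp only [skipWalk, Function.update_self]
      exact hP.finish _ _ (hl.trans (nextKept_spec c L F l).1)
    · simp [skipWalk, Function.update_of_ne hij, hP.finish i l hl]
  arc i l := by
    rcases hP.skip_arc j c F i l with h | h
    · exact Or.inr h
    · rw [h]
      exact (hP.arc i l).imp id fun h => Finset.mem_union_left _ h
  inj i l i' l' he hA := by
    have h1 := (hP.skip_arc j c F i l).resolve_left hA
    have h2 := (hP.skip_arc j c F i' l').resolve_left (he ▸ hA)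
    rw [h1, h2] at he
    refine hP.inj i l i' l' he fun h => hA ?_
    rw [h1]
    exact Finset.mem_union_left _ h

/-- If the new arcs respect `S` and some position after a crossing is deleted, the shortened flow
has fewer crossings. -/
lemma AugFlow.card_crossings_skip_lt (hP : AugFlow E A s t lam L P) {j : Fin lam} {c : ℕ → V}
    {F : Finset V} (hS : Separates E (skipArcs A P L j c F) Z s t S) {a : ℕ} (ha : P j a ∈ S)
    (ha' : P j (a + 1) ∉ S) (hdel : Deleted c L F (a + 1)) :
    (crossings (skipWalk P L j c F) L S).card < (crossings P L S).card := by
  have hnew : ∀ x : Fin lam × ℕ, x ∈ crossings (skipWalk P L j c F) L S →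
      (skipWalk P L j c F x.1 x.2, skipWalk P L j c F x.1 (x.2 + 1)) ∉ skipArcs A P L j c F := by
    intro x hx h
    obtain ⟨h1, h2⟩ := ((hP.skip j c F).mem_crossings hS.sink).mp hx
    exact h2 (hS.closed _ h h1)
  refine Finset.card_lt_card ((Finset.ssubset_iff_of_subset ?_).mpr ⟨(j, a), ?_, fun h => ?_⟩)
  · intro x hx
    obtain ⟨h1, h2⟩ := ((hP.skip j c F).mem_crossings hS.sink).mp hx
    have h3 := Prod.mk.inj ((hP.skip_arc j c F x.1 x.2).resolve_left (hnew x hx))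
    exact (hP.mem_crossings hS.sink).mpr ⟨h3.1 ▸ h1, h3.2 ▸ h2⟩
  · exact (hP.mem_crossings hS.sink).mpr ⟨ha, ha'⟩
  · refine hnew _ h ?_
    simp only [skipWalk, Function.update_self]
    by_cases h1 : Deleted c L F a
    · rw [nextKept_of_deleted h1]
      exact Finset.mem_union_left _ (hP.loop _)
    · rw [nextKept_of_not_deleted h1]
      refine Finset.mem_union_right _ (Finset.mem_image.mpr ⟨a, ?_, rfl⟩)
      have := hdel.2.1
      exact Finset.mem_filter.mpr ⟨Finset.mem_range.mpr (by omega), hdel⟩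

/-- Positions up to `x` of a walk that lie outside `S` or directly follow such a position. -/
noncomputable def outerPositions (p : ℕ → V) (S : Set V) (x : ℕ) : Finset ℕ :=
  (Finset.range (x + 1)).filter (fun e => p e ∉ S ∨ 1 ≤ e ∧ p (e - 1) ∉ S)

/-- Positions after `x` of a walk that directly follow its exit from `S`. -/
noncomputable def laterExits (p : ℕ → V) (L : ℕ) (S : Set V) (x : ℕ) : Finset ℕ :=
  (Finset.range (L + 1)).filter (fun e => x < e ∧ p (e - 1) ∈ S ∧ p e ∉ S)

lemma AugFlow.skipArcs_separates (hP : AugFlow E A s t lam L P) (hS : Separates E A Z s t S)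
    {j : Fin lam} {c : ℕ → V} {F : Finset V} {x : ℕ} (hx : P j x ∈ S)
    (h0 : ∀ e ∈ outerPositions (P j) S x, c e ∈ F) (h1 : ∀ e ∈ laterExits (P j) L S x, c e ∉ F) :
    Separates E (skipArcs A P L j c F) Z s t S where
  source := hS.source
  sink := hS.sink
  cut := hS.cut
  closed e he h := by
    rcases Finset.mem_union.mp he with he | he
    · exact hS.closed e he h
    obtain ⟨l, hl, rfl⟩ := Finset.mem_image.mp he
    obtain ⟨hlL, hdel⟩ := Finset.mem_filter.mp hl
    simp only at h ⊢
    by_contra hout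
    set l' := nextKept c L F (l + 1) with hl'
    have hspec := nextKept_spec c L F (l + 1)
    rw [← hl'] at hspec
    obtain ⟨hle, hkept⟩ := hspec
    have hne : l' ≠ l + 1 := fun h => hkept (h ▸ hdel)
    have hdelm : ∀ m, l + 1 ≤ m → m < l' → Deleted c L F m := fun m hm hm' =>
      deleted_of_lt_nextKept hm hm'
    have hspecial : ∀ m, l + 1 ≤ m → m ≤ l' → c m ∈ F := by
      intro m hm hm'
      rcases hm'.lt_or_eq with h' | rfl
      · exact (hdelm m hm h').2.2.1
      · have := (hdelm (l' - 1) (by omega) (by omega)).2.2.2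
        rwa [Nat.sub_add_cancel (by omega)] at this
    obtain ⟨m, hm, hmS, hmT⟩ := exists_last (Q := fun i => P j i ∈ S ∧ i < l') (b := l') (a := l)
      ⟨h, by omega⟩ (fun i hi hi' => absurd hi'.2 (not_lt.mpr hi))
    have hm1 : P j (m + 1) ∉ S := by
      rcases Nat.lt_or_ge (m + 1) l' with h' | h'
      · exact fun h'' => hmT (m + 1) (Nat.lt_succ_self m) ⟨h'', h'⟩
      · have : m + 1 = l' := by have := hmS.2; omega
        rwa [this]
    have hmL := hP.lt_of_mem hS.sink hmS.1
    have hmx : m + 1 ≤ x := by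
      by_contra hcon
      refine h1 (m + 1) ?_ (hspecial _ (by omega) (by have := hmS.2; omega))
      simp only [laterExits, Finset.mem_filter, Finset.mem_range, Nat.add_sub_cancel]
      exact ⟨by omega, by omega, hmS.1, hm1⟩
    rcases Nat.lt_or_ge x l' with hxl | hxl
    · exact hmT x (by omega) ⟨hx, hxl⟩
    · have hxne : l' ≠ x := fun h => hout (h ▸ hx)
      have hxL := hP.lt_of_mem hS.sink hx
      refine hkept ⟨by omega, by omega, hspecial l' hle le_rfl, h0 (l' + 1) ?_⟩
      simp only [outerPositions, Finset.mem_filter, Finset.mem_range, Nat.add_sub_cancel]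
      exact ⟨by omega, Or.inr ⟨by omega, hout⟩⟩

end

lemma card_image_le_of_factor {α β γ : Type*} (M : Finset α) (c : α → β) (u : α → γ)
    (h : ∀ a ∈ M, ∀ b ∈ M, u a = u b → c a = c b) : (M.image c).card ≤ (M.image u).card := by
  rcases M.eq_empty_or_nonempty with rfl | ⟨a₀, -⟩
  · simp
  let g : γ → β := fun y => if h : ∃ a ∈ M, u a = y then c h.choose else c a₀
  have hsub : M.image c ⊆ (M.image u).image g := by
    intro y hy
    obtain ⟨a, ha, rfl⟩ := Finset.mem_image.mp hy
    refine Finset.mem_image.mpr ⟨u a, Finset.mem_image_of_mem u ha, ?_⟩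
    have hex : ∃ b ∈ M, u b = u a := ⟨a, ha, rfl⟩
    simp only [g, dif_pos hex]
    exact h _ hex.choose_spec.1 _ ha hex.choose_spec.2
  exact (Finset.card_le_card hsub).trans Finset.card_image_le

/-- The vertex of the `i`-th walk at the first position from which position `l` of the `j`-th walk
is reachable. -/
noncomputable def firstVertex (E A : Finset (V × V)) {lam : ℕ} (P : Fin lam → ℕ → V)
    (i j : Fin lam) (l : ℕ) : V :=
  P i (firstReach E A P i (P j l))

section
variable {E A Z : Finset (V × V)} {s t : V} {lam L : ℕ} {P : Fin lam → ℕ → V} {S : Set V}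

lemma AugFlow.firstReach_le_of_firstVertex (hP : AugFlow E A s t lam L P) {i j : Fin lam}
    {l l' : ℕ} (h : firstVertex E A P i j l = firstVertex E A P i j l') :
    firstReach E A P i (P j l') ≤ firstReach E A P i (P j l) := by
  refine hP.firstReach_le_iff.mpr ?_
  have := hP.firstReach_spec i j l'
  rw [firstVertex, firstVertex] at h
  rwa [h]

/-- A residual walk leaving `S` does so at the tail of an arc of `Z` or at the end of an entry. -/
lemma AugFlow.exists_exit (hP : AugFlow E A s t lam L P) (hS : Separates E A Z s t S) {u v : V}
    (hu : u ∈ S) (hv : v ∉ S) (h : AugReach E A P u v) :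
    ∃ y ∈ Z.image Prod.fst ∪ (entries P L S).image (fun a => P a.1 (a.2 + 1)),
      AugReach E A P u y ∧ AugReach E A P y v := by
  induction h using Relation.ReflTransGen.head_induction_on with
  | refl => exact (hv hu).elim
  | @head a b hab hbv ih =>
    by_cases hb : b ∈ S
    · obtain ⟨y, hy, h1, h2⟩ := ih hb
      exact ⟨y, hy, .head hab h1, h2⟩
    · refine ⟨a, ?_, .refl, .head hab hbv⟩
      rcases hab with (hA | ⟨hE, -⟩) | ⟨j, l, hl, hl'⟩
      · exact (hb (hS.closed _ hA hu)).elim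
      · exact Finset.mem_union_left _ (Finset.mem_image.mpr ⟨_, hS.cut _ hE hu hb, rfl⟩)
      · refine Finset.mem_union_right _ (Finset.mem_image.mpr ⟨(j, l), ?_, hl'⟩)
        exact (hP.mem_entries hS.sink).mpr ⟨by rwa [hl], by rwa [hl']⟩

lemma AugFlow.card_outer_le (hP : AugFlow E A s t lam L P) (hS : Separates E A Z s t S)
    {i j : Fin lam} {x a : ℕ} (ha : ∀ l ≤ a, P i l ∈ S) (hx : AugReach E A P (P i a) (P j x)) :
    ((outerPositions (P j) S x).image (firstVertex E A P i j)).card ≤ 3 * Z.card := by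
  set c := firstVertex E A P i j with hc
  set M := (Finset.range (x + 1)).filter (fun e => P j e ∉ S) with hM
  set M' := (Finset.range (x + 1)).filter (fun e => P j e ∈ S ∧ 1 ≤ e ∧ P j (e - 1) ∉ S) with hM'
  have hent := (hP.card_entries_le hS.sink).trans (hP.card_crossings_le hS)
  have hsub : outerPositions (P j) S x ⊆ M ∪ M' := by
    intro e he
    simp only [outerPositions, Finset.mem_filter] at he
    simp only [hM, hM', Finset.mem_union, Finset.mem_filter]
    tauto
  have hM'card : M'.card ≤ Z.card := by
    refine le_trans (Finset.card_le_card_of_injOn (t := entries P L S) (fun e => (j, e - 1)) ?_ ?_)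
      hent
    · intro e he
      obtain ⟨-, h1, h2, h3⟩ := Finset.mem_filter.mp he
      exact (hP.mem_entries hS.sink).mpr ⟨h3, by simpa [Nat.sub_add_cancel h2] using h1⟩
    · intro e he e' he' h
      obtain ⟨-, -, h2, -⟩ := Finset.mem_filter.mp he
      obtain ⟨-, -, h2', -⟩ := Finset.mem_filter.mp he'
      have := (Prod.mk.inj h).2
      omega
  have hMcard : (M.image c).card ≤ 2 * Z.card := by
    have hex : ∀ e, e ∈ M → ∃ y ∈ Z.image Prod.fst ∪
        (entries P L S).image (fun a => P a.1 (a.2 + 1)),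
        AugReach E A P (c e) y ∧ AugReach E A P y (P j e) := by
      intro e he
      obtain ⟨h1, h2⟩ := Finset.mem_filter.mp he
      rw [Finset.mem_range] at h1
      refine hP.exists_exit hS (ha _ ?_) h2 (hP.firstReach_spec i j e)
      exact (hP.firstReach_mono i j (by omega)).trans (hP.firstReach_le_iff.mpr hx)
    have : Nonempty V := ⟨s⟩
    choose! y hyD hy1 hy2 using hex
    have h1 : (M.image c).card ≤ (M.image y).card := by
      refine card_image_le_of_factor M c y fun e he e' he' h => ?_
      have g1 : firstReach E A P i (P j e') ≤ firstReach E A P i (P j e) :=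
        hP.firstReach_le_iff.mpr ((hy1 e he).trans (h ▸ hy2 e' he'))
      have g2 : firstReach E A P i (P j e) ≤ firstReach E A P i (P j e') :=
        hP.firstReach_le_iff.mpr ((hy1 e' he').trans (h ▸ hy2 e he))
      rw [hc, firstVertex, firstVertex, le_antisymm g1 g2]
    have h2 : (M.image y).card ≤ (Z.image Prod.fst ∪
        (entries P L S).image (fun a => P a.1 (a.2 + 1))).card :=
      Finset.card_le_card (Finset.image_subset_iff.mpr hyD)
    have h3 := Finset.card_union_le (Z.image Prod.fst)
      ((entries P L S).image (fun a => P a.1 (a.2 + 1)))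
    have h4 : (Z.image Prod.fst).card ≤ Z.card := Finset.card_image_le
    have h5 : ((entries P L S).image (fun a => P a.1 (a.2 + 1))).card ≤ _ := Finset.card_image_le
    omega
  have h1 := Finset.card_le_card (Finset.image_subset_image (f := c) hsub)
  rw [Finset.image_union] at h1
  have h2 := Finset.card_union_le (M.image c) (M'.image c)
  have h3 : (M'.image c).card ≤ M'.card := Finset.card_image_le
  omega

lemma AugFlow.card_laterExits_le (hP : AugFlow E A s t lam L P) (hS : Separates E A Z s t S)
    (j : Fin lam) (x : ℕ) : (laterExits (P j) L S x).card ≤ Z.card := by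
  refine le_trans (Finset.card_le_card_of_injOn (t := crossings P L S) (fun e => (j, e - 1)) ?_ ?_)
    (hP.card_crossings_le hS)
  · intro e he
    obtain ⟨-, h1, h2, h3⟩ := Finset.mem_filter.mp he
    exact (hP.mem_crossings hS.sink).mpr ⟨h2, by simpa [Nat.sub_add_cancel (by omega : 1 ≤ e)]⟩
  · intro e he e' he' h
    obtain ⟨-, h1, -⟩ := Finset.mem_filter.mp he
    obtain ⟨-, h1', -⟩ := Finset.mem_filter.mp he'
    have := (Prod.mk.inj h).2
    omega

/-- If the `j`-th walk re-enters `S` up to a position `x` that is reachable from the initial part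
of the `i`-th walk while `x + 1` is not, then few vertices have to be separated in order to
shorten the `j`-th walk and lose a crossing. -/
lemma AugFlow.exists_skip (hP : AugFlow E A s t lam L P) (hS : Separates E A Z s t S)
    {i j : Fin lam} {a b x : ℕ} (ha : ∀ l ≤ a, P i l ∈ S) (hb : P j b ∈ S)
    (hb' : P j (b + 1) ∉ S) (hbx : b < x) (hxS : P j x ∈ S)
    (hx : AugReach E A P (P i a) (P j x)) (hx' : ¬ AugReach E A P (P i a) (P j (x + 1))) :
    ∃ I₀ I₁ : Finset V, I₀.Nonempty ∧ Disjoint I₀ I₁ ∧ (I₀ ∪ I₁).card ≤ 4 * Z.card ∧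
      ∀ F : Finset V, I₀ ⊆ F → Disjoint I₁ F →
        Separates E (skipArcs A P L j (firstVertex E A P i j) F) Z s t S ∧
        (crossings (skipWalk P L j (firstVertex E A P i j) F) L S).card <
          (crossings P L S).card := by
  set c := firstVertex E A P i j with hc
  have hbx1 : b + 1 < x := by
    rcases (Nat.succ_le_of_lt hbx).lt_or_eq with h | h
    · exact h
    · exact (hb' (by rwa [← Nat.succ_eq_add_one, h])).elim
  have hxL := hP.lt_of_mem hS.sink hxS
  have hb1 : b + 1 ∈ outerPositions (P j) S x := by
    simp only [outerPositions, Finset.mem_filter, Finset.mem_range]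
    exact ⟨by omega, Or.inl hb'⟩
  have hb2 : b + 2 ∈ outerPositions (P j) S x := by
    simp only [outerPositions, Finset.mem_filter, Finset.mem_range]
    exact ⟨by omega, Or.inr ⟨by omega, hb'⟩⟩
  refine ⟨(outerPositions (P j) S x).image c, (laterExits (P j) L S x).image c,
    ⟨c (b + 1), Finset.mem_image_of_mem c hb1⟩, ?_, ?_, ?_⟩
  · rw [Finset.disjoint_left]
    intro v hv hv'
    obtain ⟨e, he, rfl⟩ := Finset.mem_image.mp hv
    obtain ⟨e', he', heq⟩ := Finset.mem_image.mp hv'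
    have h1 := hP.firstReach_le_of_firstVertex (i := i) (j := j) heq.symm
    have h2 : e ≤ x := by
      have := (Finset.mem_filter.mp he).1
      rw [Finset.mem_range] at this
      omega
    have h3 : x < e' := (Finset.mem_filter.mp he').2.1
    refine hx' (hP.firstReach_le_iff.mp ((hP.firstReach_mono i j (Nat.succ_le_of_lt h3)).trans
      (h1.trans ((hP.firstReach_mono i j h2).trans (hP.firstReach_le_iff.mpr hx)))))
  · have h1 := Finset.card_union_le ((outerPositions (P j) S x).image c)
      ((laterExits (P j) L S x).image c)
    have h2 := hP.card_outer_le hS ha hx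
    rw [← hc] at h2
    have h3 := hP.card_laterExits_le hS j x
    have h4 : ((laterExits (P j) L S x).image c).card ≤ _ := Finset.card_image_le
    omega
  · intro F h0 h1
    have h0' : ∀ e ∈ outerPositions (P j) S x, c e ∈ F := fun e he =>
      h0 (Finset.mem_image_of_mem c he)
    have hsep := hP.skipArcs_separates hS (c := c) (F := F) hxS h0' fun e he =>
      Finset.disjoint_left.mp h1 (Finset.mem_image_of_mem c he)
    exact ⟨hsep, hP.card_crossings_skip_lt hsep hb hb'
      ⟨by omega, by omega, h0' _ hb1, h0' _ hb2⟩⟩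

end

lemma mem_arcsOf_map_range (p : ℕ → V) (L : ℕ) (e : V × V) :
    e ∈ arcsOf ((List.range (L + 1)).map p) ↔ ∃ l < L, (p l, p (l + 1)) = e := by
  have h : arcsOf ((List.range (L + 1)).map p) = (List.range L).map (fun l => (p l, p (l + 1))) := by
    refine List.ext_getElem (by simp [arcsOf]) fun i h1 h2 => ?_
    simp [arcsOf]
  simp [h]

lemma isPathIn_map_range {B : Set (V × V)} {s t : V} {p : ℕ → V} {L : ℕ}
    (h : ∀ l < L, (p l, p (l + 1)) ∈ B) (h0 : p 0 = s) (hL : p L = t) :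
    IsPathIn B s t ((List.range (L + 1)).map p) := by
  refine ⟨?_, ?_, ?_⟩
  · change List.IsChain _ _
    rw [List.isChain_iff_getElem]
    intro i hi
    simp only [List.length_map, List.length_range] at hi
    simpa using h i (by omega)
  · simp [List.head?_range, h0]
  · simp [List.range_succ, hL]

lemma reach_exit {B : Set (V × V)} {u v : V} (h : Reach B u v) {Y : Set V} (hu : u ∈ Y)
    (hv : v ∉ Y) : ∃ e ∈ B, e.1 ∈ Y ∧ e.2 ∉ Y := by
  by_contra hcon
  push Not at hcon
  refine hv ?_
  induction h with
  | refl => exact hu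
  | tail _ hbc ih => exact hcon _ hbc (not_not.mp fun hb => hb (by by_contra hb'; exact hb' (ih hb')))

lemma reach_walk {B : Set (V × V)} {p : ℕ → V} {a b : ℕ} (hab : a ≤ b)
    (h : ∀ l, a ≤ l → l < b → (p l, p (l + 1)) ∈ B) : Reach B (p a) (p b) := by
  induction b, hab using Nat.le_induction with
  | base => exact .refl
  | succ n hn ih => exact (ih fun l h1 h2 => h l h1 (by omega)).tail (h n hn (by omega))

section
variable {E A Z : Finset (V × V)} {s t : V} {lam L : ℕ} {P : Fin lam → ℕ → V}

lemma IsStarCut.separates (hZ : IsStarCut E s t Z) (hA : Compatible E s Z A) :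
    Separates E A Z s t (sSide E s Z) where
  source := Relation.ReflTransGen.refl
  sink := hZ.1.2
  closed := hA
  cut e he h h' := by
    by_contra hz
    exact h' (Relation.ReflTransGen.tail (show Reach _ s e.1 from h) ⟨he, hz⟩)

/-- A flow whose walks leave the set `Y` exactly once, at the positions `a`, with no further arc
leaving `Y`, certifies that the core of `Z` is a minimum cut and yields a witnessing flow. -/
lemma AugFlow.isMinCutAug_of_closed (hP : AugFlow E A s t lam L P) (hZ : IsStarCut E s t Z)
    (hA : Compatible E s Z A) {a : Fin lam → ℕ}
    (ha : ∀ j l, P j l ∈ sSide E s Z ↔ l ≤ a j) {Y : Set V} (hSY : sSide E s Z ⊆ Y) (htY : t ∉ Y)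
    (hY : ∀ e, e ∈ E ∨ e ∈ A → e.1 ∈ Y → e.2 ∉ Y → ∃ j, (P j (a j), P j (a j + 1)) = e) :
    IsMinCutAug E A s t (coreAug E A Z t) ∧ WitnessingFlow E A Z s t := by
  have hS := hZ.separates hA
  have haC : ∀ j, (P j (a j), P j (a j + 1)) ∉ A ∧ (P j (a j), P j (a j + 1)) ∈ Z := fun j =>
    hP.crossing_mem hS ((ha j _).mpr le_rfl) fun h => by
      have := (ha j _).mp h; omega
  have haL : ∀ j, a j < L := fun j => hP.lt_of_mem hS.sink ((ha j _).mpr le_rfl)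
  have hcore : coreAug E A Z t = Finset.univ.image (fun j => (P j (a j), P j (a j + 1))) := by
    ext e
    simp only [coreAug, Finset.mem_filter, Finset.mem_image, Finset.mem_univ, true_and]
    constructor
    · rintro ⟨heZ, hr⟩
      refine hY e (Or.inl (hZ.1.1 heZ)) (hSY (hZ.2 e heZ).1) fun he2 => ?_
      obtain ⟨e', he', h1, h2⟩ := reach_exit hr he2 htY
      obtain ⟨j, rfl⟩ := hY e' (he'.imp (fun h => h.1) id) h1 h2
      rcases he' with h | h
      · exact h.2 (haC j).2
      · exact (haC j).1 h
    · rintro ⟨j, rfl⟩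
      refine ⟨(haC j).2, ?_⟩
      have := reach_walk (B := ((E : Set (V × V)) \ (Z : Set (V × V))) ∪ (A : Set (V × V)))
        (p := P j) (Nat.succ_le_of_lt (haL j)) fun l hl _ => by
          rcases hP.arc j l with h | h
          · refine Or.inl ⟨h, fun hz => ?_⟩
            have := (ha j l).mp (hZ.2 _ hz).1
            omega
          · exact Or.inr h
      rwa [hP.finish j L le_rfl] at this
  have hinj : Function.Injective (fun j => (P j (a j), P j (a j + 1))) := fun i j h =>
    (hP.inj _ _ _ _ h (haC i).1).1
  have hcard : (coreAug E A Z t).card = lam := by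
    rw [hcore, Finset.card_image_of_injective _ hinj]; simp
  have hmem : ∀ j, (P j (a j), P j (a j + 1)) ∈ coreAug E A Z t := fun j => by
    rw [hcore]; exact Finset.mem_image_of_mem _ (Finset.mem_univ j)
  have hCmem : ∀ e ∈ coreAug E A Z t, ∃ j, (P j (a j), P j (a j + 1)) = e := fun e he => by
    rw [hcore] at he
    simpa using he
  refine ⟨⟨⟨?_, ?_⟩, ?_⟩, ?_⟩
  · exact (Finset.filter_subset _ _).trans hZ.1.1
  · intro hr
    obtain ⟨e, he, h1, h2⟩ := reach_exit hr (hSY hS.source) htY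
    obtain ⟨j, rfl⟩ := hY e (he.imp (fun h => h.1) id) h1 h2
    rcases he with h | h
    · exact h.2 (hmem j)
    · exact (haC j).1 h
  · rintro Z' ⟨-, hZ'⟩
    have : ∀ j, ∃ l, (P j l, P j (l + 1)) ∈ Z' ∧ (P j l, P j (l + 1)) ∉ A := by
      intro j
      by_contra hcon
      push Not at hcon
      refine hZ' ?_
      have := reach_walk (B := ((E : Set (V × V)) \ (Z' : Set (V × V))) ∪ (A : Set (V × V)))
        (p := P j) (Nat.zero_le L) fun l _ _ => by
          by_cases hz : (P j l, P j (l + 1)) ∈ Z'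
          · exact Or.inr (hcon l hz)
          · exact (hP.arc j l).imp (fun h => ⟨h, hz⟩) id
      rwa [hP.start, hP.finish j L le_rfl] at this
    choose l hl hlA using this
    rw [hcard]
    have := Finset.card_le_card_of_injOn (s := (Finset.univ : Finset (Fin lam))) (t := Z')
      (fun j => (P j (l j), P j (l j + 1))) (fun j _ => hl j)
      (fun i _ j _ h => (hP.inj _ _ _ _ h (hlA i)).1)
    simpa using this
  · refine ⟨fun i => (List.range (L + 1)).map (P (Fin.cast hcard i)), ?_, ?_, ?_, ?_⟩
    · exact fun i => isPathIn_map_range (fun l _ => hP.arc _ l) (hP.start _) (hP.finish _ L le_rfl)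
    · intro i j hij e hi hj he
      obtain ⟨l, -, rfl⟩ := (mem_arcsOf_map_range _ _ _).mp hi
      obtain ⟨l', -, h⟩ := (mem_arcsOf_map_range _ _ _).mp hj
      have := (hP.inj _ _ _ _ h.symm he.2).1
      exact hij (by simpa using this)
    · intro i
      refine ⟨_, ⟨hmem (Fin.cast hcard i), (mem_arcsOf_map_range _ _ _).mpr
        ⟨a (Fin.cast hcard i), haL _, rfl⟩⟩, ?_⟩
      rintro e ⟨he, he'⟩
      obtain ⟨l, -, rfl⟩ := (mem_arcsOf_map_range _ _ _).mp he'
      obtain ⟨j, h⟩ := hCmem _ he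
      obtain ⟨rfl, rfl⟩ := hP.inj _ _ _ _ h (haC j).1
      rfl
    · intro i e he heZ
      obtain ⟨l, -, rfl⟩ := (mem_arcsOf_map_range _ _ _).mp he
      have h1 := (ha _ _).mp (hZ.2 _ heZ).1
      have h2 := mt (ha _ _).mpr (hZ.2 _ heZ).2
      obtain rfl : l = a (Fin.cast hcard i) := by omega
      exact hmem _

/-- Unless the flow can be augmented, lifted, or shortened, it certifies the cut `Z`. -/
lemma AugFlow.progress_or_done (hP : AugFlow E A s t lam L P) (hZ : IsStarCut E s t Z)
    (hA : Compatible E s Z A) :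
    AugReach E A P s t ∨
    (∃ i j a b, (∀ l ≤ a, P i l ∈ sSide E s Z) ∧ (∀ l, b < l → P j l ∉ sSide E s Z) ∧
      AugReach E A P (P i a) (P j (b + 1))) ∨
    (∃ i j a b x, (∀ l ≤ a, P i l ∈ sSide E s Z) ∧ P j b ∈ sSide E s Z ∧
      P j (b + 1) ∉ sSide E s Z ∧ b < x ∧ P j x ∈ sSide E s Z ∧
      AugReach E A P (P i a) (P j x) ∧ ¬ AugReach E A P (P i a) (P j (x + 1))) ∨
    (IsMinCutAug E A s t (coreAug E A Z t) ∧ WitnessingFlow E A Z s t) := by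
  have hS := hZ.separates hA
  obtain ⟨a, ha⟩ := hP.exists_first_exit hS
  obtain ⟨b, hb⟩ := hP.exists_last_exit hS
  by_contra hcon
  simp only [not_or] at hcon
  obtain ⟨h1, h2, h3, h4⟩ := hcon
  replace h2 : ∀ i j, ¬ AugReach E A P (P i (a i)) (P j (b j + 1)) := fun i j h =>
    h2 ⟨i, j, a i, b j, (ha i).1, (hb j).2, h⟩
  replace h3 : ∀ i j x, a j < x → P j x ∈ sSide E s Z → AugReach E A P (P i (a i)) (P j x) →
      AugReach E A P (P i (a i)) (P j (x + 1)) := fun i j x hx hxS hr => by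
    by_contra h
    exact h3 ⟨i, j, a i, a j, x, (ha i).1, (ha j).1 _ le_rfl, (ha j).2, hx, hxS, hr, h⟩
  set Y : Set V := {v | AugReach E A P s v ∨ ∃ i, AugReach E A P (P i (a i)) v} with hYdef
  have hYr : ∀ u v, u ∈ Y → AugReach E A P u v → v ∈ Y := fun u v hu huv =>
    hu.imp (fun h => h.trans huv) fun ⟨i, h⟩ => ⟨i, h.trans huv⟩
  have hYj : ∀ (_ : Fin lam) v, v ∈ Y → ∃ i, AugReach E A P (P i (a i)) v := by
    rintro j v (h | h)
    · have h0 := augReach_backward (E := E) (A := A) (P := P) j (Nat.zero_le (a j))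
      rw [hP.start] at h0
      exact ⟨j, h0.trans h⟩
    · exact h
  have hYa : ∀ j l, l ≤ a j → P j l ∈ Y := fun j l hl => Or.inr ⟨j, augReach_backward j hl⟩
  have hYb : ∀ j, P j (b j + 1) ∉ Y := fun j hj => by
    obtain ⟨i, hi⟩ := hYj j _ hj
    exact h2 i j hi
  have htY : t ∉ Y := by
    rintro (h | ⟨i, h⟩)
    · exact h1 h
    · exact h2 i i (h.trans (hP.reach_from_t i _))
  have hused : ∀ e, e ∈ E ∨ e ∈ A → e.1 ∈ Y → e.2 ∉ Y → ∃ j l, (P j l, P j (l + 1)) = e := by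
    intro e he hu hv
    by_contra hun
    push Not at hun
    refine hv (hYr _ _ hu (.single (Or.inl ?_)))
    exact he.symm.imp id fun h => ⟨h, hun⟩
  have hSY : sSide E s Z ⊆ Y := by
    intro v hv
    change Reach _ s v at hv
    unfold Reach at hv
    induction hv with
    | refl => exact Or.inl .refl
    | @tail u v hu huv ih =>
      by_contra hvY
      obtain ⟨j, l, hl⟩ := hused (u, v) (Or.inl huv.1) ih hvY
      obtain ⟨rfl, rfl⟩ := Prod.mk.inj hl
      have hvS : P j (l + 1) ∈ sSide E s Z := Relation.ReflTransGen.tail hu huv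
      rcases lt_trichotomy l (a j) with h | rfl | h
      · exact hvY (hYa j _ h)
      · exact (ha j).2 hvS
      · obtain ⟨i, hi⟩ := hYj j _ ih
        exact hvY (Or.inr ⟨i, h3 i j l h hu hi⟩)
  have hab : ∀ j, a j = b j := by
    intro j
    have h5 : a j ≤ b j := by
      by_contra h
      exact (hb j).2 (a j) (by omega) ((ha j).1 _ le_rfl)
    by_contra hne
    obtain ⟨i, hi⟩ := hYj j _ (hSY (hb j).1)
    exact h2 i j (h3 i j (b j) (by omega) (hb j).1 hi)
  have haY : ∀ j, P j (a j + 1) ∉ Y := fun j => by rw [hab j]; exact hYb j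
  refine h4 (hP.isMinCutAug_of_closed hZ hA (a := a) (fun j l => ⟨fun h => ?_, (ha j).1 l⟩) hSY htY
    (fun e he hu hv => ?_))
  · by_contra hlt
    exact (hb j).2 l (by rw [← hab j]; omega) h
  · obtain ⟨j, l, rfl⟩ := hused e he hu hv
    refine ⟨j, ?_⟩
    have h5 : l ≤ a j := by
      by_contra h
      exact haY j (hYr _ _ hu (augReach_backward j (by omega)))
    have h6 : ¬ l + 1 ≤ a j := fun h => hv (hYa j _ h)
    obtain rfl : l = a j := by omega
    rfl

end

/-- Few coordinates suffice to distinguish the elements of a finite set. -/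
lemma exists_distinguishing {ι : Type*} {bit : V → ι → Bool} (hbit : Function.Injective bit)
    (M : Finset V) : ∃ B : Finset ι, B.card ≤ M.card ∧
      ∀ u ∈ M, ∀ v ∈ M, (∀ r ∈ B, bit u r = bit v r) → u = v := by
  induction M using Finset.induction_on with
  | empty => exact ⟨∅, by simp⟩
  | @insert x M hx ih =>
    obtain ⟨B, hB, hsep⟩ := ih
    by_cases hy : ∃ y ∈ M, ∀ r ∈ B, bit x r = bit y r
    · obtain ⟨y, hyM, hy⟩ := hy
      have hne : bit x ≠ bit y := fun h => hx (by rwa [hbit h])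
      obtain ⟨r₀, hr₀⟩ := Function.ne_iff.mp hne
      have hxsep : ∀ v ∈ M, ¬ ∀ r ∈ insert r₀ B, bit x r = bit v r := fun v hv h => by
        have h1 : y = v := hsep y hyM v hv fun r hr =>
          (hy r hr).symm.trans (h r (Finset.mem_insert_of_mem hr))
        exact hr₀ (by rw [h1]; exact h r₀ (Finset.mem_insert_self _ _))
      refine ⟨insert r₀ B, ?_, ?_⟩
      · rw [Finset.card_insert_of_notMem hx]
        exact (Finset.card_insert_le _ _).trans (by omega)
      · intro u hu v hv h
        rcases Finset.mem_insert.mp hu with rfl | hu' <;>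
          rcases Finset.mem_insert.mp hv with rfl | hv'
        · rfl
        · exact (hxsep v hv' h).elim
        · exact (hxsep u hu' fun r hr => (h r hr).symm).elim
        · exact hsep u hu' v hv' fun r hr => h r (Finset.mem_insert_of_mem hr)
    · push Not at hy
      refine ⟨B, hB.trans (Finset.card_le_card (Finset.subset_insert x M)), ?_⟩
      intro u hu v hv h
      rcases Finset.mem_insert.mp hu with rfl | hu' <;>
        rcases Finset.mem_insert.mp hv with rfl | hv'
      · rfl
      · obtain ⟨r, hr, hne⟩ := hy v hv'
        exact (hne (h r hr)).elim
      · obtain ⟨r, hr, hne⟩ := hy u hu'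
        exact (hne (h r hr).symm).elim
      · exact hsep u hu' v hv' h

lemma exists_enumeration {α : Type*} {m : ℕ} (T : Finset α) (hT : T.card ≤ m) (d : α) :
    ∃ f : Fin m → α, (∀ x ∈ T, ∃ i, f i = x) ∧ ∀ i, f i = d ∨ f i ∈ T := by
  refine ⟨fun i => if h : i.1 < T.card then (T.equivFin.symm ⟨i.1, h⟩ : α) else d, ?_, ?_⟩
  · intro x hx
    have h1 := (T.equivFin ⟨x, hx⟩).2
    refine ⟨⟨(T.equivFin ⟨x, hx⟩).1, by omega⟩, ?_⟩
    simp
  · intro i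
    by_cases h : i.1 < T.card
    · right
      simp only [h, dif_pos]
      exact (T.equivFin.symm ⟨i.1, h⟩).2
    · left
      simp [h]

/-- A small family of sets separating any two disjoint sets with at most `m` elements in total. -/
lemma exists_separating_family [Fintype V] {ι : Type} [Fintype ι] [Nonempty ι]
    {bit : V → ι → Bool} (hbit : Function.Injective bit) (m : ℕ) :
    ∃ 𝓕 : Finset (Finset V), 𝓕.card ≤ Fintype.card ι ^ m * 2 ^ (m * m) ∧
      ∀ I₀ I₁ : Finset V, I₀.Nonempty → Disjoint I₀ I₁ → (I₀ ∪ I₁).card ≤ m →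
        ∃ F ∈ 𝓕, I₀ ⊆ F ∧ Disjoint I₁ F := by
  refine ⟨(Finset.univ : Finset ((Fin m → ι) × (Fin m → Fin m → Bool))).image
    (fun x => Finset.univ.filter (fun v => ∃ i, ∀ r, bit v (x.1 r) = x.2 i r)), ?_, ?_⟩
  · refine Finset.card_image_le.trans (le_of_eq ?_)
    simp [Fintype.card_prod, pow_mul]
  · intro I₀ I₁ ⟨d, hd⟩ hdisj hcard
    obtain ⟨B, hB, hsep⟩ := exists_distinguishing hbit (I₀ ∪ I₁)
    obtain ⟨f, hf, -⟩ := exists_enumeration B (hB.trans hcard) (Classical.arbitrary ι)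
    obtain ⟨g, hg, hg'⟩ := exists_enumeration I₀
      ((Finset.card_le_card Finset.subset_union_left).trans hcard) d
    refine ⟨_, Finset.mem_image.mpr ⟨(f, fun i r => bit (g i) (f r)), Finset.mem_univ _, rfl⟩,
      ?_, ?_⟩
    · intro v hv
      obtain ⟨i, rfl⟩ := hg v hv
      exact Finset.mem_filter.mpr ⟨Finset.mem_univ _, i, fun r => rfl⟩
    · rw [Finset.disjoint_left]
      intro v hv hv'
      obtain ⟨-, i, hi⟩ := Finset.mem_filter.mp hv'
      have hgi : g i ∈ I₀ := (hg' i).elim (fun h => h ▸ hd) id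
      have : v = g i := hsep v (Finset.mem_union_right _ hv) _ (Finset.mem_union_left _ hgi)
        fun r hr => by obtain ⟨q, rfl⟩ := hf r hr; exact hi q
      exact Finset.disjoint_left.mp hdisj hgi (this ▸ hv)

lemma exists_injective_bits (V : Type) [Fintype V] :
    ∃ bit : V → Fin (Nat.log 2 (Fintype.card V) + 1) → Bool, Function.Injective bit := by
  refine ⟨fun v i => (Fintype.equivFin V v).1.testBit i.1, fun u v h => ?_⟩
  have hlt : ∀ w : V, (Fintype.equivFin V w).1 < 2 ^ (Nat.log 2 (Fintype.card V) + 1) := fun w =>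
    (Fintype.equivFin V w).2.trans (Nat.lt_pow_succ_log_self (by norm_num) _)
  refine (Fintype.equivFin V).injective (Fin.ext (Nat.eq_of_testBit_eq fun i => ?_))
  rcases Nat.lt_or_ge i (Nat.log 2 (Fintype.card V) + 1) with hi | hi
  · exact congrFun h ⟨i, hi⟩
  · have hpow : 2 ^ (Nat.log 2 (Fintype.card V) + 1) ≤ 2 ^ i := Nat.pow_le_pow_right (by norm_num) hi
    rw [Nat.testBit_lt_two_pow ((hlt u).trans_le hpow),
      Nat.testBit_lt_two_pow ((hlt v).trans_le hpow)]

/-- `A` augments `G` in such a way that the core of `Z` becomes a minimum cut. -/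
def Augments (E : Finset (V × V)) (s t : V) (Z A : Finset (V × V)) : Prop :=
  Compatible E s Z A ∧ IsMinCutAug E A s t (coreAug E A Z t) ∧ WitnessingFlow E A Z s t

/-- Starting from a flow, a bounded number of sets suffices to augment all compatible star cuts
whose progress measure is below `N`. -/
lemma exists_family [Fintype V] {E : Finset (V × V)} {s t : V} {k q : ℕ} {𝓕 : Finset (Finset V)}
    (hq : 𝓕.card ≤ q)
    (h𝓕 : ∀ I₀ I₁ : Finset V, I₀.Nonempty → Disjoint I₀ I₁ → (I₀ ∪ I₁).card ≤ 4 * k →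
      ∃ F ∈ 𝓕, I₀ ⊆ F ∧ Disjoint I₁ F) (N : ℕ) :
    ∀ (A : Finset (V × V)) (lam L : ℕ) (P : Fin lam → ℕ → V), AugFlow E A s t lam L P →
      ∃ 𝒜 : Finset (Finset (V × V)), 𝒜.card ≤ (2 + k ^ 2 + k ^ 2 * q) ^ N ∧
        ∀ Z, IsStarCut E s t Z → Z.card ≤ k → Compatible E s Z A →
          (k + 1) * (k - lam) + (crossings P L (sSide E s Z)).card < N →
          ∃ A' ∈ 𝒜, Augments E s t Z A' := by
  induction N with
  | zero => exact fun A lam L P _ => ⟨∅, by simp, fun Z _ _ _ h => absurd h (Nat.not_lt_zero _)⟩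
  | succ N ih =>
    intro A lam L P hP
    set B := 2 + k ^ 2 + k ^ 2 * q with hB
    have hle : ∀ {A' lam' L'} {P' : Fin lam' → ℕ → V}, AugFlow E A' s t lam' L' P' → ∀ Z,
        IsStarCut E s t Z → Z.card ≤ k → Compatible E s Z A' →
        lam' ≤ (crossings P' L' (sSide E s Z)).card ∧
          (crossings P' L' (sSide E s Z)).card ≤ k := fun hP' Z hZ hk hA' =>
      ⟨hP'.le_card_crossings (hZ.separates hA'),
        (hP'.card_crossings_le (hZ.separates hA')).trans hk⟩
    rcases Nat.lt_or_ge k lam with hlam | hlam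
    · refine ⟨∅, by simp, fun Z hZ hk hA _ => ?_⟩
      have := hle hP Z hZ hk hA
      omega
    have hup : ∀ A' L' (P' : Fin (lam + 1) → ℕ → V), AugFlow E A' s t (lam + 1) L' P' →
        ∃ 𝒜 : Finset (Finset (V × V)), 𝒜.card ≤ B ^ N ∧
          ∀ Z, IsStarCut E s t Z → Z.card ≤ k → Compatible E s Z A' →
            (k + 1) * (k - lam) + (crossings P L (sSide E s Z)).card < N + 1 →
            ∃ A' ∈ 𝒜, Augments E s t Z A' := by
      intro A' L' P' hP'
      obtain ⟨𝒜, hcard, h𝒜⟩ := ih A' _ L' P' hP'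
      refine ⟨𝒜, hcard, fun Z hZ hk hA' hN => h𝒜 Z hZ hk hA' ?_⟩
      obtain ⟨h1, h2⟩ := hle hP' Z hZ hk hA'
      have h3 : k - lam = k - (lam + 1) + 1 := by omega
      rw [h3, mul_add, mul_one] at hN
      omega
    obtain ⟨𝒜₁, h𝒜₁card, h𝒜₁⟩ : ∃ 𝒜 : Finset (Finset (V × V)), 𝒜.card ≤ B ^ N ∧
        (AugReach E A P s t → ∀ Z, IsStarCut E s t Z → Z.card ≤ k → Compatible E s Z A →
          (k + 1) * (k - lam) + (crossings P L (sSide E s Z)).card < N + 1 →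
          ∃ A' ∈ 𝒜, Augments E s t Z A') := by
      by_cases hr : AugReach E A P s t
      · obtain ⟨L', P', hP'⟩ := hP.augment hr
        obtain ⟨𝒜, h1, h2⟩ := hup A L' P' hP'
        exact ⟨𝒜, h1, fun _ => h2⟩
      · exact ⟨∅, by simp, fun h => (hr h).elim⟩
    have hlift : ∀ x : Fin lam × Fin lam, ∃ 𝒜 : Finset (Finset (V × V)), 𝒜.card ≤ B ^ N ∧
        ∀ Z, IsStarCut E s t Z → Z.card ≤ k → Compatible E s Z (liftArcs E A P L x.1 x.2) →
          (k + 1) * (k - lam) + (crossings P L (sSide E s Z)).card < N + 1 →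
          ∃ A' ∈ 𝒜, Augments E s t Z A' := fun x => by
      obtain ⟨L', P', hP'⟩ := hP.exists_liftArcs x.1 x.2
      exact hup _ L' P' hP'
    choose 𝒜₂ h𝒜₂card h𝒜₂ using hlift
    have hskip : ∀ x : (Fin lam × Fin lam) × Finset V, ∃ 𝒜 : Finset (Finset (V × V)),
        𝒜.card ≤ B ^ N ∧ ∀ Z, IsStarCut E s t Z → Z.card ≤ k →
          Compatible E s Z (skipArcs A P L x.1.2 (firstVertex E A P x.1.1 x.1.2) x.2) →
          (k + 1) * (k - lam) + (crossings (skipWalk P L x.1.2 (firstVertex E A P x.1.1 x.1.2) x.2)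
            L (sSide E s Z)).card < N →
          ∃ A' ∈ 𝒜, Augments E s t Z A' := fun x => ih _ _ L _ (hP.skip _ _ _)
    choose 𝒜₃ h𝒜₃card h𝒜₃ using hskip
    refine ⟨{A} ∪ 𝒜₁ ∪ Finset.univ.biUnion 𝒜₂ ∪ (Finset.univ ×ˢ 𝓕).biUnion 𝒜₃, ?_, ?_⟩
    · have c1 := Finset.card_union_le ({A} ∪ 𝒜₁ ∪ Finset.univ.biUnion 𝒜₂)
        ((Finset.univ ×ˢ 𝓕).biUnion 𝒜₃)
      have c2 := Finset.card_union_le ({A} ∪ 𝒜₁) (Finset.univ.biUnion 𝒜₂)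
      have c3 := Finset.card_union_le {A} 𝒜₁
      have c4 : (Finset.univ.biUnion 𝒜₂).card ≤ _ :=
        Finset.card_biUnion_le_card_mul _ 𝒜₂ (B ^ N) fun x _ => h𝒜₂card x
      have c5 : ((Finset.univ ×ˢ 𝓕).biUnion 𝒜₃).card ≤ _ :=
        Finset.card_biUnion_le_card_mul _ 𝒜₃ (B ^ N) fun x _ => h𝒜₃card x
      simp only [Finset.card_univ, Fintype.card_prod, Fintype.card_fin, Finset.card_product,
        Finset.card_singleton] at c3 c4 c5
      have c6 : lam * lam ≤ k ^ 2 := by rw [sq]; exact Nat.mul_le_mul hlam hlam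
      have c7 : lam * lam * B ^ N ≤ k ^ 2 * B ^ N := Nat.mul_le_mul_right _ c6
      have c8 : lam * lam * 𝓕.card * B ^ N ≤ k ^ 2 * q * B ^ N :=
        Nat.mul_le_mul_right _ (Nat.mul_le_mul c6 hq)
      have c9 : 1 ≤ B ^ N := Nat.one_le_pow _ _ (by omega)
      have c10 : B ^ (N + 1) = 2 * B ^ N + k ^ 2 * B ^ N + k ^ 2 * q * B ^ N := by
        rw [pow_succ]; nth_rewrite 2 [hB]; ring
      omega
    · intro Z hZ hk hA hN
      have hS := hZ.separates hA
      rcases hP.progress_or_done hZ hA with hr | ⟨i, j, a, b, ha, hb, hr⟩ |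
        ⟨i, j, a, b, x, ha, hb, hb', hbx, hxS, hx, hx'⟩ | hdone
      · obtain ⟨A', hA', h⟩ := h𝒜₁ hr Z hZ hk hA hN
        exact ⟨A', by simp [hA'], h⟩
      · obtain ⟨A', hA', h⟩ := h𝒜₂ (i, j) Z hZ hk (hP.liftArcs_separates hS ha hb hr).closed hN
        refine ⟨A', Finset.mem_union_left _ (Finset.mem_union_right _ ?_), h⟩
        exact Finset.mem_biUnion.mpr ⟨(i, j), Finset.mem_univ _, hA'⟩
      · obtain ⟨I₀, I₁, hne, hdisj, hcard, hI⟩ := hP.exists_skip hS ha hb hb' hbx hxS hx hx'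
        obtain ⟨F, hF, hF0, hF1⟩ := h𝓕 I₀ I₁ hne hdisj (hcard.trans (by omega))
        obtain ⟨hS', hlt⟩ := hI F hF0 hF1
        obtain ⟨A', hA', h⟩ := h𝒜₃ ((i, j), F) Z hZ hk hS'.closed (by simp only; omega)
        refine ⟨A', Finset.mem_union_right _ ?_, h⟩
        exact Finset.mem_biUnion.mpr
          ⟨((i, j), F), Finset.mem_product.mpr ⟨Finset.mem_univ _, hF⟩, hA'⟩
      · exact ⟨A, by simp, hA, hdone⟩

lemma family_bound (k b : ℕ) {Λ : ℝ} (hΛ : 2 ≤ Λ) (hb : (b : ℝ) ≤ 2 * Λ) :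
    (((2 + k ^ 2 + k ^ 2 * (b ^ (4 * k) * 2 ^ (4 * k * (4 * k)))) ^ ((k + 2) ^ 2) : ℕ) : ℝ) ≤
      (2 : ℝ) ^ (40 * ((k : ℝ) + 2) ^ 4 * Real.log ((k : ℝ) + 2)) *
        Λ ^ (40 * ((k : ℝ) + 2) ^ 3) := by
  set K := k + 2 with hK
  have hkK : (k : ℝ) + 2 = (K : ℝ) := by rw [hK]; push_cast; ring
  rw [hkK]
  have hq : ((b ^ (4 * k) * 2 ^ (4 * k * (4 * k)) : ℕ) : ℝ) ≤
      (2 * Λ) ^ (4 * K) * 2 ^ (16 * K ^ 2) := by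
    push_cast
    gcongr ?_ * ?_
    · calc (b : ℝ) ^ (4 * k) ≤ (2 * Λ) ^ (4 * k) := by gcongr
        _ ≤ _ := pow_le_pow_right₀ (by linarith) (by omega)
    · exact pow_le_pow_right₀ (by norm_num) (by rw [hK]; nlinarith)
  have hX1 : (1 : ℝ) ≤ (2 * Λ) ^ (4 * K) * 2 ^ (16 * K ^ 2) :=
    one_le_mul_of_one_le_of_one_le (one_le_pow₀ (by linarith)) (one_le_pow₀ (by norm_num))
  have hK2 : (2 : ℝ) + k ^ 2 + k ^ 2 ≤ 2 ^ (1 + 2 * K) := by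
    have h1 : (K : ℝ) ≤ 2 ^ K := by exact_mod_cast Nat.lt_two_pow_self.le
    have h2 : (k : ℝ) = K - 2 := by linarith
    have h3 : (2 : ℝ) ≤ K := by rw [hK]; push_cast; linarith [(Nat.cast_nonneg k : (0 : ℝ) ≤ k)]
    calc (2 : ℝ) + k ^ 2 + k ^ 2 ≤ 2 * (K : ℝ) ^ 2 := by rw [h2]; nlinarith
      _ ≤ 2 * (2 ^ K) ^ 2 := by gcongr
      _ = _ := by rw [← pow_mul, pow_add, pow_one, mul_comm K 2]
  have hB : ((2 + k ^ 2 + k ^ 2 * (b ^ (4 * k) * 2 ^ (4 * k * (4 * k))) : ℕ) : ℝ) ≤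
      2 ^ (23 * K ^ 2) * Λ ^ (4 * K) := by
    calc ((2 + k ^ 2 + k ^ 2 * (b ^ (4 * k) * 2 ^ (4 * k * (4 * k))) : ℕ) : ℝ)
        = (2 + (k : ℝ) ^ 2) * 1 + k ^ 2 * ((b ^ (4 * k) * 2 ^ (4 * k * (4 * k)) : ℕ) : ℝ) := by
          push_cast; ring
      _ ≤ (2 + (k : ℝ) ^ 2) * ((2 * Λ) ^ (4 * K) * 2 ^ (16 * K ^ 2)) +
          k ^ 2 * ((2 * Λ) ^ (4 * K) * 2 ^ (16 * K ^ 2)) := by gcongr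
      _ = (2 + (k : ℝ) ^ 2 + k ^ 2) * ((2 * Λ) ^ (4 * K) * 2 ^ (16 * K ^ 2)) := by ring
      _ ≤ 2 ^ (1 + 2 * K) * ((2 * Λ) ^ (4 * K) * 2 ^ (16 * K ^ 2)) := by gcongr
      _ = 2 ^ (1 + 6 * K + 16 * K ^ 2) * Λ ^ (4 * K) := by
          rw [mul_pow, show 1 + 6 * K + 16 * K ^ 2 = (1 + 2 * K) + 4 * K + 16 * K ^ 2 by ring,
            pow_add, pow_add]
          ring
      _ ≤ _ := by
          gcongr
          · norm_num
          · have : 2 ≤ K := by omega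
            nlinarith
  have hlog : (23 : ℝ) ≤ 40 * Real.log K := by
    have h1 : Real.log 2 ≤ Real.log K := Real.log_le_log (by norm_num) (by
      rw [hK]; push_cast; linarith [(Nat.cast_nonneg k : (0 : ℝ) ≤ k)])
    linarith [Real.log_two_gt_d9]
  calc (((2 + k ^ 2 + k ^ 2 * (b ^ (4 * k) * 2 ^ (4 * k * (4 * k)))) ^ (K ^ 2) : ℕ) : ℝ)
      = ((2 + k ^ 2 + k ^ 2 * (b ^ (4 * k) * 2 ^ (4 * k * (4 * k))) : ℕ) : ℝ) ^ (K ^ 2) := by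
        rw [Nat.cast_pow]
    _ ≤ (2 ^ (23 * K ^ 2) * Λ ^ (4 * K)) ^ (K ^ 2) := by gcongr
    _ = 2 ^ (23 * K ^ 4) * Λ ^ (4 * K ^ 3) := by
        rw [mul_pow, ← pow_mul, ← pow_mul]; ring_nf
    _ = (2 : ℝ) ^ (23 * (K : ℝ) ^ 4) * Λ ^ (4 * (K : ℝ) ^ 3) := by
        rw [← Real.rpow_natCast, ← Real.rpow_natCast]; push_cast; rfl
    _ ≤ _ := by
        gcongr ?_ * ?_
        · refine Real.rpow_le_rpow_of_exponent_le (by norm_num) ?_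
          have : (0 : ℝ) ≤ (K : ℝ) ^ 4 := by positivity
          nlinarith
        · refine Real.rpow_le_rpow_of_exponent_le (by linarith) ?_
          gcongr
          norm_num

lemma log_two_succ_le (n : ℕ) : ((Nat.log 2 n + 1 : ℕ) : ℝ) ≤ 2 * (2 + Real.log n) := by
  rcases Nat.eq_zero_or_pos n with rfl | hn
  · norm_num
  · have h1 : ((2 ^ Nat.log 2 n : ℕ) : ℝ) ≤ n := by exact_mod_cast Nat.pow_log_le_self 2 hn.ne'
    have h2 := Real.log_le_log (by positivity) h1
    rw [Nat.cast_pow, Real.log_pow] at h2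
    push_cast at h2 ⊢
    have h3 : (0 : ℝ) ≤ Nat.log 2 n := Nat.cast_nonneg _
    nlinarith [Real.log_two_gt_d9]

/-- Deterministic flow-augmentation for star `st`-cuts with a witnessing flow
(Theorem `thm:dir-flow-augmentation-det`). -/
theorem flow_augmentation_deterministic_star :
    ∃ C : ℝ, 0 < C ∧
      ∀ (V : Type) [Fintype V] [DecidableEq V] (E : Finset (V × V)) (s t : V),
        s ≠ t → ∀ k : ℕ,
          ∃ 𝒜 : Finset (Finset (V × V)),
            (𝒜.card : ℝ) ≤
                (2 : ℝ) ^ (C * ((k : ℝ) + 2) ^ 4 * Real.log ((k : ℝ) + 2)) *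
                  (2 + Real.log (Fintype.card V)) ^ (C * ((k : ℝ) + 2) ^ 3) ∧
            ∀ Z : Finset (V × V), IsStarCut E s t Z → Z.card ≤ k →
              ∃ A ∈ 𝒜, Compatible E s Z A ∧ IsMinCutAug E A s t (coreAug E A Z t) ∧
                WitnessingFlow E A Z s t := by
  refine ⟨40, by norm_num, fun V _ _ E s t _ k => ?_⟩
  obtain ⟨bit, hbit⟩ := exists_injective_bits V
  obtain ⟨𝓕, hcard, h𝓕⟩ := exists_separating_family hbit (4 * k)
  rw [Fintype.card_fin] at hcard
  have hP : AugFlow E (Finset.univ.image fun v => (v, v)) s t 0 0 Fin.elim0 :=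
    ⟨fun v => Finset.mem_image_of_mem _ (Finset.mem_univ v), fun j => j.elim0, fun j => j.elim0,
      fun j => j.elim0, fun j => j.elim0⟩
  obtain ⟨𝒜, h𝒜card, h𝒜⟩ := exists_family hcard h𝓕 ((k + 2) ^ 2) _ _ _ _ hP
  have hlog : 0 ≤ Real.log (Fintype.card V) := Real.log_natCast_nonneg _
  refine ⟨𝒜, le_trans (Nat.cast_le.mpr h𝒜card)
    (family_bound k _ (by linarith) (log_two_succ_le _)), fun Z hZ hk => h𝒜 Z hZ hk ?_ ?_⟩
  · intro e he h
    obtain ⟨v, -, rfl⟩ := Finset.mem_image.mp he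
    exact h
  · have : (crossings (Fin.elim0 : Fin 0 → ℕ → V) 0 (sSide E s Z)).card = 0 := by
      simp [crossings]
    rw [this, Nat.sub_zero]
    nlinarith

end FlowAug
end

section
/- If Z is a star st-cut in a directed graph G, then core(Z) is a minimal st-cut of G: core(Z) is an st-cut and no proper subset of core(Z) is an st-cut. -/
open scoped Classical

namespace FlowAug

variable {V : Type}

/-- If `Z` is a star `st`-cut, then `core(Z)` is a minimal `st`-cut. -/
theorem core_isMinimalCut (V : Type) [Fintype V] [DecidableEq V]
    (E : Finset (V × V)) (s t : V) (hst : s ≠ t)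
    (Z : Finset (V × V)) (hZ : IsStarCut E s t Z) :
    IsCut E s t (core E Z t) ∧ ∀ Z', Z' ⊂ core E Z t → ¬ IsCut E s t Z' := by
  have mem_core : ∀ e, e ∈ core E Z t ↔
      e ∈ Z ∧ Reach ((E : Set (V × V)) \ (Z : Set (V × V))) e.2 t :=
    fun e => Finset.mem_filter
  refine ⟨⟨fun e he => hZ.1.1 ((mem_core e).1 he).1, fun h => ?_⟩, ?_⟩
  · refine hZ.1.2 ?_
    clear hst hZ
    induction h using Relation.ReflTransGen.head_induction_on with
    | refl => exact Relation.ReflTransGen.refl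
    | @head u v huv _ ih =>
      refine Relation.ReflTransGen.head ⟨huv.1, fun hz => huv.2 ?_⟩ ih
      exact (mem_core (u, v)).2 ⟨hz, ih⟩
  · rintro Z' hss ⟨-, hcut⟩
    have hsub := hss.1
    obtain ⟨e, he, he'⟩ := Finset.exists_of_ssubset hss
    obtain ⟨heZ, het⟩ := (mem_core e).1 he
    have mono : ∀ a b, Reach ((E : Set (V × V)) \ (Z : Set (V × V))) a b →
        Reach ((E : Set (V × V)) \ (Z' : Set (V × V))) a b := fun a b h =>
      Relation.ReflTransGen.mono
        (fun _ _ hxy => ⟨hxy.1, fun hz => hxy.2 ((mem_core _).1 (hsub hz)).1⟩) a b h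
    exact hcut ((mono _ _ (hZ.2 e heZ).1).trans
      (Relation.ReflTransGen.head ⟨hZ.1.1 heZ, he'⟩ (mono _ _ het)))

end FlowAug
end

section
/- If Z is a star st-cut in a directed graph G and A ⊆ V × V is compatible with Z, then for every vertex w ∈ V, w is reachable from s using arcs of (E ∖ Z) ∪ A if and only if w is reachable from s using arcs of E ∖ Z; consequently Z is a star st-cut in the augmented graph G+A (Z is an st-cut of G+A and for every arc (u,v) ∈ Z, s reaches u but does not reach v using arcs of (E ∖ Z) ∪ A). -/
open scoped Classical

namespace FlowAug

variable {V : Type}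

/-- Adding arcs that do not leave the set of vertices reachable from `s` does not
change reachability from `s`. -/
theorem reach_union_iff {B A : Set (V × V)} {s : V}
    (h : ∀ e ∈ A, Reach B s e.1 → Reach B s e.2) (w : V) :
    Reach (B ∪ A) s w ↔ Reach B s w := by
  constructor
  · intro hw
    induction hw with
    | refl => exact Relation.ReflTransGen.refl
    | tail _ harc ih =>
      rcases harc with hB | hA
      · exact Relation.ReflTransGen.tail ih hB
      · exact h _ hA ih
  · exact fun hw => Relation.ReflTransGen.mono (fun _ _ h => Or.inl h) _ _ hw

/-- If `A` is compatible with the star `st`-cut `Z`, then the `s`-side of `Z` is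
unchanged in `G + A` and `Z` remains a star `st`-cut in `G + A`
(Lemma `lem:star-cut-stays`). -/
theorem starCut_stays (V : Type) [Fintype V] [DecidableEq V]
    (E : Finset (V × V)) (s t : V) (hst : s ≠ t)
    (Z A : Finset (V × V)) (hZ : IsStarCut E s t Z) (hA : Compatible E s Z A) :
    (∀ w : V,
        Reach (((E : Set (V × V)) \ (Z : Set (V × V))) ∪ (A : Set (V × V))) s w ↔
          Reach ((E : Set (V × V)) \ (Z : Set (V × V))) s w) ∧
    IsCutAug E A s t Z ∧
    ∀ e ∈ Z,
      Reach (((E : Set (V × V)) \ (Z : Set (V × V))) ∪ (A : Set (V × V))) s e.1 ∧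
      ¬ Reach (((E : Set (V × V)) \ (Z : Set (V × V))) ∪ (A : Set (V × V))) s e.2 := by
  have key := reach_union_iff (B := (E : Set (V × V)) \ (Z : Set (V × V)))
    (A := (A : Set (V × V))) (s := s) hA
  exact ⟨key, ⟨hZ.1.1, fun h => hZ.1.2 ((key t).1 h)⟩, fun e he =>
    ⟨(key e.1).2 (hZ.2 e he).1, fun h => (hZ.2 e he).2 ((key e.2).1 h)⟩⟩

end FlowAug
end

section
/- Let G be a directed graph with proper boundaries and let P = {P₁,…,P_λ} be a maximum st-flow in G whose reachability pattern has only self-loops. Then for every choice of one bottleneck arc e_i lying on each path P_i (i ∈ {1,…,λ}), the set {e₁,…,e_λ} is a minimum st-cut of G. -/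
open scoped Classical

namespace FlowAug

variable {V : Type}

theorem mem_of_mem_arcsOf {p : List V} {u v : V} (h : (u, v) ∈ arcsOf p) : u ∈ p ∧ v ∈ p :=
  ⟨(List.of_mem_zip h).1, List.mem_of_mem_tail (List.of_mem_zip h).2⟩

theorem reach_of_forall_arcsOf {A : Set (V × V)} {s t : V} {p : List V}
    (hs : p.head? = some s) (ht : p.getLast? = some t) (h : ∀ a ∈ arcsOf p, a ∈ A) :
    Reach A s t := by
  induction p generalizing s with
  | nil => simp at hs
  | cons a l ih =>
    obtain rfl : a = s := by simpa using hs
    cases l with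
    | nil =>
      obtain rfl : a = t := by simpa using ht
      exact Relation.ReflTransGen.refl
    | cons b l =>
      refine Relation.ReflTransGen.head (h (a, b) (by simp [arcsOf])) (ih rfl ?_ ?_)
      · simpa using ht
      · exact fun x hx => h x (List.mem_cons_of_mem _ hx)

theorem forall_arcsOf_of_isChain {R : V → V → Prop} {p : List V} (h : p.IsChain R) :
    ∀ a ∈ arcsOf p, R a.1 a.2 := by
  induction p with
  | nil => simp [arcsOf]
  | cons a l ih =>
    cases l with
    | nil => simp [arcsOf]
    | cons b l =>
      rw [List.isChain_cons_cons] at h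
      intro x hx
      rcases List.mem_cons.1 hx with rfl | hx
      · exact h.1
      · exact ih h.2 x hx

theorem IsPathIn.arcsOf_subset {A : Set (V × V)} {s t : V} {p : List V} (h : IsPathIn A s t p) :
    ∀ a ∈ arcsOf p, a ∈ A :=
  forall_arcsOf_of_isChain (R := fun u v => (u, v) ∈ A) h.1

/-- Every cut meets every path. -/
theorem IsCut.exists_mem_arcsOf {E Z : Finset (V × V)} {s t : V} (hZ : IsCut E s t Z)
    {p : List V} (hp : IsPathIn (E : Set (V × V)) s t p) : ∃ a ∈ arcsOf p, a ∈ Z := by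
  by_contra! h
  exact hZ.2 (reach_of_forall_arcsOf hp.2.1 hp.2.2
    fun a ha => ⟨hp.arcsOf_subset a ha, by simpa using h a ha⟩)

theorem IsMinCut.card_eq {E Z : Finset (V × V)} {s t : V} (hZ : IsMinCut E s t Z)
    {lam : ℕ} {P : Fin lam → List V} (hP : IsMaxFlow E s t P) : Z.card = lam := by
  obtain ⟨Z', hZ', h⟩ := hP.2
  exact h ▸ le_antisymm (hZ.2 _ hZ'.1) (hZ'.2 _ hZ.1)

/-- The arcs of a minimum cut are listed by the paths of a maximum flow. -/
theorem IsMinCut.exists_arc_choice {E Z : Finset (V × V)} {s t : V} (hZ : IsMinCut E s t Z)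
    {lam : ℕ} {P : Fin lam → List V} (hP : IsMaxFlow E s t P) :
    ∃ f : Fin lam → V × V, (∀ i, f i ∈ arcsOf (P i)) ∧ ∀ z ∈ Z, ∃ i, f i = z := by
  choose f hfP hfZ using fun i => hZ.1.exists_mem_arcsOf (hP.1.1 i)
  have hinj : Function.Injective f := fun i j hij => by
    by_contra hne
    exact hP.1.2 i j hne (f i) ⟨hfP i, hij ▸ hfP j⟩
  have himage : Finset.univ.image f = Z := by
    refine Finset.eq_of_subset_of_card_le ?_ ?_
    · simpa [Finset.subset_iff] using hfZ
    · rw [Finset.card_image_of_injective _ hinj, hZ.card_eq hP, Finset.card_fin]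
  refine ⟨f, hfP, fun z hz => ?_⟩
  rw [← himage] at hz
  simpa using hz

theorem IsMinCut.exists_mem_arcsOf_flow {E Z : Finset (V × V)} {s t : V} (hZ : IsMinCut E s t Z)
    {lam : ℕ} {P : Fin lam → List V} (hP : IsMaxFlow E s t P) {z : V × V} (hz : z ∈ Z) :
    ∃ i, z ∈ arcsOf (P i) := by
  obtain ⟨f, hf, hfZ⟩ := hZ.exists_arc_choice hP
  obtain ⟨i, rfl⟩ := hfZ z hz
  exact ⟨i, hf i⟩

/-- A minimum cut contains only one arc of each path of a maximum flow. -/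
theorem IsMinCut.eq_of_mem_arcsOf {E Z : Finset (V × V)} {s t : V} (hZ : IsMinCut E s t Z)
    {lam : ℕ} {P : Fin lam → List V} (hP : IsMaxFlow E s t P) {i : Fin lam} {a b : V × V}
    (ha : a ∈ Z) (hb : b ∈ Z) (haP : a ∈ arcsOf (P i)) (hbP : b ∈ arcsOf (P i)) : a = b := by
  obtain ⟨f, hf, hfZ⟩ := hZ.exists_arc_choice hP
  have key : ∀ c ∈ Z, c ∈ arcsOf (P i) → f i = c := by
    intro c hc hcP
    obtain ⟨j, rfl⟩ := hfZ c hc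
    by_contra hne
    exact hP.1.2 i j (fun h => hne (h ▸ rfl)) _ ⟨hcP, hf j⟩
  rw [← key a ha haP, ← key b hb hbP]

/-- An arc leaving the source side of `Z` belongs to `Z`. -/
theorem mem_of_sSide_exit {E Z : Finset (V × V)} {s u v : V} (huv : (u, v) ∈ E)
    (hu : u ∈ sSide E s Z) (hv : v ∉ sSide E s Z) : (u, v) ∈ Z := by
  by_contra h
  exact hv (Relation.ReflTransGen.tail hu ⟨huv, by simpa using h⟩)

/-- Second half of Lemma `lem:base-case-structure`: with proper boundaries and a
self-loops-only reachability pattern, any choice of one bottleneck arc from each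
flow path forms a minimum `st`-cut. -/
theorem base_case_bottlenecks_form_minCut (V : Type) [Fintype V] [DecidableEq V]
    (E : Finset (V × V)) (s t : V) (hst : s ≠ t)
    (hpb : ProperBoundaries E s t)
    (lam : ℕ) (P : Fin lam → List V) (hP : IsMaxFlow E s t P)
    (hself : OnlySelfLoops E s t P)
    (e : Fin lam → V × V)
    (he : ∀ i, Bottleneck E s t (e i) ∧ e i ∈ arcsOf (P i)) :
    IsMinCut E s t (Finset.image e Finset.univ) := by
  have hs : ∀ Z, s ∈ sSide E s Z := fun Z => Relation.ReflTransGen.refl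
  choose hbot heP using he
  choose Z hZ heZ using hbot
  have htZ : ∀ i, t ∉ sSide E s (Z i) := fun i => (hZ i).1.2
  -- Arcs of `P j` other than `e j` do not leave the source side of `Z j`.
  have hstay : ∀ j u v, (u, v) ∈ arcsOf (P j) → (u, v) ≠ e j → u ∈ sSide E s (Z j) →
      v ∈ sSide E s (Z j) := by
    intro j u v huv hne hu
    by_contra hv
    have hmem := mem_of_sSide_exit ((hP.1.1 j).arcsOf_subset _ huv) hu hv
    exact hne ((hZ j).eq_of_mem_arcsOf hP hmem (heZ j) huv (heP j))
  let S : Set V := {v | v = s ∨ ∃ i, v ∈ sSide E s (Z i) ∧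
    ∃ u ∈ P i, u ≠ s ∧ u ≠ t ∧ ResReach E P u v}
  have htS : t ∉ S := by
    rintro (h | ⟨i, h, -⟩)
    · exact hst h.symm
    · exact htZ i h
  have henter : ∀ j v, v ∈ P j → v ∈ sSide E s (Z j) → v ∈ S := by
    intro j v hv hvZ
    by_cases hvs : v = s
    · exact Or.inl hvs
    · exact Or.inr ⟨j, hvZ, v, hv, hvs, fun h => htZ j (h ▸ hvZ), Relation.ReflTransGen.refl⟩
  have hclosed : ∀ u v, u ∈ S → (u, v) ∈ E → (∀ i, (u, v) ≠ e i) → v ∈ S := by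
    intro u v hu huv hne
    have hut : u ≠ t := fun h => htS (h ▸ hu)
    by_cases hused : ∃ j, (u, v) ∈ arcsOf (P j)
    · obtain ⟨j, hj⟩ := hused
      have huZ : u ∈ sSide E s (Z j) := by
        by_cases hus : u = s
        · exact hus ▸ hs _
        rcases hu with hu | ⟨i, huZ, w, hw, hws, hwt, hreach⟩
        · exact absurd hu hus
        obtain rfl : i = j := by
          by_contra hij
          exact hself i j hij w hw hws hwt u (mem_of_mem_arcsOf hj).1 hus hut hreach
        exact huZ
      exact henter j v (mem_of_mem_arcsOf hj).2 (hstay j u v hj (hne j) huZ)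
    · rcases hu with rfl | ⟨i, huZ, w, hw, hws, hwt, hreach⟩
      · exact absurd (hpb.1.exists_mem_arcsOf_flow hP (by simpa using huv)) hused
      · refine Or.inr ⟨i, ?_, w, hw, hws, hwt, hreach.tail (Or.inl ⟨huv, not_exists.1 hused⟩)⟩
        by_contra hv
        exact hused ((hZ i).exists_mem_arcsOf_flow hP (mem_of_sSide_exit huv huZ hv))
  have hreach : ∀ v, Reach ((E : Set (V × V)) \ (Finset.image e Finset.univ : Finset (V × V))) s v →
      v ∈ S := by
    intro v h
    induction h with
    | refl => exact Or.inl rfl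
    | tail _ huv ih =>
      refine hclosed _ _ ih huv.1 fun i h => huv.2 ?_
      simp [h]
  refine ⟨⟨?_, fun h => htS (hreach t h)⟩, fun Z' hZ' => ?_⟩
  · intro a ha
    obtain ⟨i, -, rfl⟩ := Finset.mem_image.1 ha
    exact (hP.1.1 i).arcsOf_subset _ (heP i)
  · obtain ⟨Z₀, hZ₀, hcard⟩ := hP.2
    calc (Finset.image e Finset.univ).card ≤ lam := by
          simpa using Finset.card_image_le (s := Finset.univ) (f := e)
      _ = Z₀.card := hcard.symm
      _ ≤ Z'.card := hZ₀.2 _ hZ'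

end FlowAug
end
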